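/- arXiv:2103.15479 — 8 statements merged into one kernel-verified Lean document; each statement's English description precedes it below -/
import Mathlib

section
/- Let f(X) = a_0 + a_1 X + ... + a_n X^n be a polynomial with integer coefficients of degree n ≥ 1, and let a, b be integers with 0 < |f(a)| < |f(b)|. Let q = max { d_2/d_1 ≤ √(|f(b)|/|f(a)|) : d_1 an admissible divisor of f(a), d_2 an admissible divisor of f(b) }, and assume q = 1. If b > a and every complex root of f has real part strictly less than (a+b)/2, or if a > b and every complex root of f has real part strictly greater than (a+b)/2, then f is irreducible over ℚ. -/
open Polynomial

/-- `d` is an admissible divisor of `f(a)`: `d ∣ f(a)` and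
`gcd(d, f(a)/d)` divides `gcd(f(a), f'(a))`. -/
def AdmissibleDivisor (f : Polynomial ℤ) (a d : ℤ) : Prop :=
  d ∣ f.eval a ∧
    Int.gcd d (f.eval a / d) ∣ Int.gcd (f.eval a) (f.derivative.eval a)

/-- The set of quotients `d₂/d₁` of admissible divisors of `f(a)` and `f(b)`
that do not exceed `√(|f(b)|/|f(a)|)`. -/
def admissibleQuotients (f : Polynomial ℤ) (a b : ℤ) : Set ℝ :=
  {x : ℝ | ∃ d₁ d₂ : ℤ, AdmissibleDivisor f a d₁ ∧ AdmissibleDivisor f b d₂ ∧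
    x = (d₂ : ℝ) / (d₁ : ℝ) ∧
    x ≤ Real.sqrt (((|f.eval b| : ℤ) : ℝ) / ((|f.eval a| : ℤ) : ℝ))}

theorem AdmissibleDivisor.abs {f : ℤ[X]} {a d : ℤ} (h : AdmissibleDivisor f a d) :
    AdmissibleDivisor f a |d| := by
  rcases abs_choice d with hd | hd <;> rw [hd]
  · exact h
  · simpa [AdmissibleDivisor] using h

theorem admissibleDivisor_eval_of_mul {g h : ℤ[X]} {a : ℤ} (ha : (g * h).eval a ≠ 0) :
    AdmissibleDivisor (g * h) a (g.eval a) := by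
  rw [eval_mul] at ha
  refine ⟨by simp, ?_⟩
  rw [eval_mul, Int.mul_ediv_cancel_left _ (left_ne_zero_of_mul ha), Int.dvd_gcd_iff]
  have hg := Int.gcd_dvd_left (g.eval a) (h.eval a)
  have hh := Int.gcd_dvd_right (g.eval a) (h.eval a)
  refine ⟨hg.mul_right _, ?_⟩
  rw [derivative_mul, eval_add, eval_mul, eval_mul]
  exact dvd_add (hh.mul_left _) (hg.mul_right _)

/-- If every complex root of `g` is closer to `x` than to `y`, then `‖g(x)‖ < ‖g(y)‖`. -/
theorem norm_eval_lt_norm_eval_of_roots {g : ℂ[X]} (hg : g.natDegree ≠ 0) {x y : ℂ}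
    (hx : g.eval x ≠ 0) (h : ∀ θ, g.IsRoot θ → ‖x - θ‖ < ‖y - θ‖) :
    ‖g.eval x‖ < ‖g.eval y‖ := by
  have hs := IsAlgClosed.splits g
  have hg0 : g ≠ 0 := by rintro rfl; simp at hg
  have norm_prod (z : ℂ) : ‖(g.roots.map (z - ·)).prod‖ = (g.roots.map (‖z - ·‖)).prod := by
    rw [← normHom_apply, map_multiset_prod, Multiset.map_map]
    rfl
  rw [hs.eval_eq_prod_roots, hs.eval_eq_prod_roots, norm_mul, norm_mul, norm_prod, norm_prod]
  refine mul_lt_mul_of_pos_left ?_ (norm_pos_iff.2 (leadingCoeff_ne_zero.2 hg0))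
  have hroot : ∀ θ ∈ g.roots, 0 < ‖x - θ‖ ∧ ‖x - θ‖ < ‖y - θ‖ := fun θ hθ =>
    ⟨norm_pos_iff.2 (sub_ne_zero.2 fun e => hx (e ▸ (mem_roots hg0).1 hθ)),
      h θ ((mem_roots hg0).1 hθ)⟩
  have hne : g.roots ≠ 0 := by
    rw [← Multiset.card_pos, ← hs.natDegree_eq_card_roots]
    exact Nat.pos_of_ne_zero hg
  obtain ⟨θ, hθ⟩ := Multiset.exists_mem_of_ne_zero hne
  obtain ⟨t, ht⟩ := Multiset.exists_cons_of_mem hθ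
  rw [ht] at hroot ⊢
  rw [Multiset.map_cons, Multiset.map_cons, Multiset.prod_cons, Multiset.prod_cons]
  have hθ' := hroot θ (Multiset.mem_cons_self _ _)
  have ht' := fun φ hφ => hroot φ (Multiset.mem_cons_of_mem hφ)
  refine mul_lt_mul hθ'.2 (Multiset.prod_map_le_prod_map₀ _ _ (fun φ _ => norm_nonneg _)
    fun φ hφ => (ht' φ hφ).2.le) (Multiset.prod_pos ?_) (norm_nonneg _)
  intro r hr
  obtain ⟨φ, hφ, rfl⟩ := Multiset.mem_map.1 hr
  exact (ht' φ hφ).1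

theorem Complex.norm_ofReal_sub_lt_norm_ofReal_sub {a b : ℝ} {θ : ℂ}
    (h : 0 < (b - a) * (a + b - 2 * θ.re)) : ‖(a : ℂ) - θ‖ < ‖(b : ℂ) - θ‖ := by
  rw [Complex.norm_def, Complex.norm_def]
  refine Real.sqrt_lt_sqrt (Complex.normSq_nonneg _) ?_
  simp only [Complex.normSq_apply, Complex.sub_re, Complex.sub_im, Complex.ofReal_re,
    Complex.ofReal_im]
  nlinarith

theorem abs_eval_lt_abs_eval_of_roots {g : ℤ[X]} (hg : g.natDegree ≠ 0) {a b : ℤ}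
    (ha : g.eval a ≠ 0) (h : ∀ θ : ℂ, aeval θ g = 0 → ‖(a : ℂ) - θ‖ < ‖(b : ℂ) - θ‖) :
    |g.eval a| < |g.eval b| := by
  have eval_cast (z : ℤ) : (g.map (Int.castRingHom ℂ)).eval (z : ℂ) = (g.eval z : ℤ) :=
    eval_intCast_map (Int.castRingHom ℂ) g z
  have key := norm_eval_lt_norm_eval_of_roots (g := g.map (Int.castRingHom ℂ))
    (x := a) (y := b) (by rwa [natDegree_map_eq_of_injective Int.cast_injective])
    (by rw [eval_cast]; exact_mod_cast ha)
    fun θ hθ => h θ (by rwa [IsRoot, eval_map, ← algebraMap_int_eq, ← aeval_def] at hθ)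
  rw [eval_cast, eval_cast, Complex.norm_intCast, Complex.norm_intCast] at key
  exact_mod_cast key

theorem sqrt_lt_abs_div_of_mul {g h : ℤ[X]} {a b : ℤ} (ha : (g * h).eval a ≠ 0)
    (hb : (g * h).eval b ≠ 0) (hq : 1 ∈ upperBounds (admissibleQuotients (g * h) a b))
    (hlt : |g.eval a| < |g.eval b|) :
    √((|(g * h).eval b| : ℤ) / (|(g * h).eval a| : ℤ) : ℝ) <
      (|g.eval b| : ℤ) / (|g.eval a| : ℤ) := by
  by_contra! hle
  have h1 := hq ⟨_, _, (admissibleDivisor_eval_of_mul ha).abs,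
    (admissibleDivisor_eval_of_mul hb).abs, rfl, hle⟩
  rw [eval_mul] at ha
  have hpos : (0 : ℝ) < (|g.eval a| : ℤ) := by
    exact_mod_cast abs_pos.2 (left_ne_zero_of_mul ha)
  rw [div_le_one hpos] at h1
  exact hlt.not_ge (by exact_mod_cast h1)

theorem not_upperBounds_admissibleQuotients_of_mul {g h : ℤ[X]} {a b : ℤ}
    (ha : (g * h).eval a ≠ 0) (hb : (g * h).eval b ≠ 0)
    (hg : |g.eval a| < |g.eval b|) (hh : |h.eval a| < |h.eval b|) :
    1 ∉ upperBounds (admissibleQuotients (g * h) a b) := by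
  intro hq
  have h1 := sqrt_lt_abs_div_of_mul ha hb hq hg
  have h2 := sqrt_lt_abs_div_of_mul (g := h) (h := g) (by rwa [mul_comm]) (by rwa [mul_comm])
    (by rwa [mul_comm]) hh
  rw [mul_comm h g] at h2
  have h3 := mul_lt_mul'' h1 h2 (Real.sqrt_nonneg _) (Real.sqrt_nonneg _)
  rw [Real.mul_self_sqrt (by positivity), eval_mul, eval_mul, abs_mul, abs_mul, Int.cast_mul,
    Int.cast_mul, mul_div_mul_comm] at h3
  exact h3.false

theorem Polynomial.IsPrimitive.natDegree_ne_zero_of_not_isUnit {p : ℤ[X]} (hp : p.IsPrimitive)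
    (hu : ¬IsUnit p) : p.natDegree ≠ 0 := fun h => by
  rw [eq_C_of_natDegree_eq_zero h] at hp hu
  exact hu ((hp _ dvd_rfl).map C)

theorem Polynomial.exists_mul_eq_of_not_irreducible_map {f : ℤ[X]} (hf : f.natDegree ≠ 0)
    (h : ¬Irreducible (f.map (Int.castRingHom ℚ))) :
    ∃ g k : ℤ[X], f = g * k ∧ g.natDegree ≠ 0 ∧ k.natDegree ≠ 0 := by
  have hf0 : f ≠ 0 := by rintro rfl; simp at hf
  have hc : IsUnit (C ((f.content : ℤ) : ℚ)) := by
    rw [isUnit_C, isUnit_iff_ne_zero]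
    exact_mod_cast mt content_eq_zero_iff.1 hf0
  have hp := f.isPrimitive_primPart
  have hirr : ¬Irreducible f.primPart := by
    rw [IsPrimitive.Int.irreducible_iff_irreducible_map_cast hp]
    rw [f.eq_C_content_mul_primPart, Polynomial.map_mul, map_C] at h
    exact fun h' => h ((irreducible_isUnit_mul hc).2 h')
  have hu : ¬IsUnit f.primPart := fun hu =>
    hf (f.natDegree_primPart ▸ natDegree_eq_zero_of_isUnit hu)
  rw [irreducible_iff] at hirr
  push Not at hirr
  obtain ⟨g, k, hgk, hg, hk⟩ := hirr hu
  have hg' := (isPrimitive_of_dvd hp ⟨k, hgk⟩).natDegree_ne_zero_of_not_isUnit hg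
  have hk' :=
    (isPrimitive_of_dvd hp ⟨g, hgk.trans (mul_comm _ _)⟩).natDegree_ne_zero_of_not_isUnit hk
  refine ⟨C f.content * g, k, ?_, ?_, hk'⟩
  · rw [mul_assoc, ← hgk, ← f.eq_C_content_mul_primPart]
  · rwa [natDegree_C_mul (mt content_eq_zero_iff.1 hf0)]

theorem statement_2 (f : Polynomial ℤ) (hdeg : 1 ≤ f.natDegree) (a b : ℤ)
    (hfa : 0 < |f.eval a|) (hfab : |f.eval a| < |f.eval b|)
    (hq : IsGreatest (admissibleQuotients f a b) 1)
    (hroots :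
      (a < b ∧ ∀ θ : ℂ, (Polynomial.aeval θ) f = 0 → θ.re < ((a : ℝ) + (b : ℝ)) / 2) ∨
      (b < a ∧ ∀ θ : ℂ, (Polynomial.aeval θ) f = 0 → ((a : ℝ) + (b : ℝ)) / 2 < θ.re)) :
    Irreducible (Polynomial.map (Int.castRingHom ℚ) f) := by
  have hroots' : ∀ θ : ℂ, aeval θ f = 0 → ‖(a : ℂ) - θ‖ < ‖(b : ℂ) - θ‖ := fun θ hθ => by
    have hpos : 0 < ((b : ℝ) - a) * (a + b - 2 * θ.re) := by
      rcases hroots with ⟨hab, h⟩ | ⟨hab, h⟩ <;> have := h θ hθ <;>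
        have hab' := Int.cast_lt (R := ℝ).2 hab
      · exact mul_pos (by linarith) (by linarith)
      · exact mul_pos_of_neg_of_neg (by linarith) (by linarith)
    exact_mod_cast Complex.norm_ofReal_sub_lt_norm_ofReal_sub hpos
  by_contra hirr
  obtain ⟨g, h, rfl, hg, hh⟩ :=
    exists_mul_eq_of_not_irreducible_map (Nat.one_le_iff_ne_zero.1 hdeg) hirr
  have ha : (g * h).eval a ≠ 0 := abs_pos.1 hfa
  have ha' := ha
  rw [eval_mul] at ha'
  refine not_upperBounds_admissibleQuotients_of_mul ha (abs_pos.1 (hfa.trans hfab)) ?_ ?_ hq.2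
  · exact abs_eval_lt_abs_eval_of_roots hg (left_ne_zero_of_mul ha')
      fun θ hθ => hroots' θ (by rw [map_mul, hθ, zero_mul])
  · exact abs_eval_lt_abs_eval_of_roots hh (right_ne_zero_of_mul ha')
      fun θ hθ => hroots' θ (by rw [map_mul, hθ, mul_zero])
end

section
/- Let f(X) = a_0 + a_1 X + ... + a_n X^n be a polynomial with integer coefficients of degree n ≥ 1, and let a, b be two integers such that a² < b² and |a_n| > Σ_{i=0}^{n-1} |a_i| · (|a+b|/2)^{i−n}. Then f is irreducible over ℚ in each of the following cases: (i) |f(a)| = p^k·r and |f(b)| = p^{k+1} for some prime p and integers k, r with k ≥ 0 and 0 < r < p; (ii) |f(a)| = p^k and |f(b)| = p^k·r for some primes p, r with r < p and some integer k ≥ 1. -/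
open Polynomial

/-- Strict Cauchy-type bound: if the leading coefficient dominates the other ones weighted by powers
of `R`, then every complex root has modulus less than `R`. -/
theorem norm_lt_of_leadingCoeff_dominant {f : ℤ[X]} {R : ℝ} (hR : 0 < R)
    (hlead : ∑ i ∈ Finset.range f.natDegree,
        ((|f.coeff i| : ℤ) : ℝ) * R ^ ((i : ℤ) - (f.natDegree : ℤ)) <
      ((|f.leadingCoeff| : ℤ) : ℝ))
    {z : ℂ} (hz : aeval z f = 0) : ‖z‖ < R := by
  by_contra! hRz
  have hz0 : 0 < ‖z‖ := hR.trans_le hRz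
  set n := f.natDegree with hn
  rw [aeval_eq_sum_range, Finset.sum_range_succ, ← hn] at hz
  have htop : ((|f.leadingCoeff| : ℤ) : ℝ) * ‖z‖ ^ n ≤
      ∑ i ∈ Finset.range n, ((|f.coeff i| : ℤ) : ℝ) * ‖z‖ ^ i := by
    have hnorm (i : ℕ) : ‖f.coeff i • z ^ i‖ = ((|f.coeff i| : ℤ) : ℝ) * ‖z‖ ^ i := by
      simp [zsmul_eq_mul]
    calc ((|f.leadingCoeff| : ℤ) : ℝ) * ‖z‖ ^ n = ‖f.coeff n • z ^ n‖ := (hnorm n).symm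
      _ = ‖∑ i ∈ Finset.range n, f.coeff i • z ^ i‖ := by
        rw [← norm_neg, neg_eq_of_add_eq_zero_left hz]
      _ ≤ ∑ i ∈ Finset.range n, ‖f.coeff i • z ^ i‖ := norm_sum_le _ _
      _ = _ := Finset.sum_congr rfl fun i _ => hnorm i
  have hlow : ∑ i ∈ Finset.range n, ((|f.coeff i| : ℤ) : ℝ) * ‖z‖ ^ i ≤
      (∑ i ∈ Finset.range n, ((|f.coeff i| : ℤ) : ℝ) * R ^ ((i : ℤ) - (n : ℤ))) * ‖z‖ ^ n := by
    rw [Finset.sum_mul]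
    refine Finset.sum_le_sum fun i hi => ?_
    rw [mul_assoc]
    refine mul_le_mul_of_nonneg_left ?_ (by positivity)
    have hin : i ≤ n := (Finset.mem_range.mp hi).le
    have hexp : (i : ℤ) - n = -((n - i : ℕ) : ℤ) := by omega
    rw [hexp, zpow_neg, zpow_natCast, inv_mul_eq_div, le_div_iff₀ (by positivity)]
    calc ‖z‖ ^ i * R ^ (n - i) ≤ ‖z‖ ^ i * ‖z‖ ^ (n - i) := by gcongr
      _ = ‖z‖ ^ n := by rw [← pow_add, Nat.add_sub_cancel' hin]
  have := mul_lt_mul_of_pos_right hlead (pow_pos hz0 n)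
  linarith

/-- A point in the open disc of radius `|a + b| / 2` is closer to `a` than to `b`
when `a ^ 2 < b ^ 2`. -/
theorem norm_sub_lt_norm_sub_of_norm_lt {a b : ℝ} (hab : a ^ 2 < b ^ 2) {z : ℂ}
    (hz : ‖z‖ < |a + b| / 2) : ‖(a : ℂ) - z‖ < ‖(b : ℂ) - z‖ := by
  have hre : |z.re| < |a + b| / 2 := (Complex.abs_re_le_norm z).trans_lt hz
  refine lt_of_pow_lt_pow_left₀ 2 (norm_nonneg _) ?_
  rw [Complex.sq_norm, Complex.sq_norm, Complex.normSq_apply, Complex.normSq_apply]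
  simp only [Complex.sub_re, Complex.sub_im, Complex.ofReal_re, Complex.ofReal_im]
  obtain ⟨h1, h2⟩ := abs_lt.mp hre
  rcases le_total 0 (a + b) with h | h
  · rw [abs_of_nonneg h] at h1 h2
    have hba : 0 < b - a := by
      by_contra! hle
      nlinarith
    nlinarith
  · rw [abs_of_nonpos h] at h1 h2
    have hba : 0 < a - b := by
      by_contra! hle
      nlinarith
    nlinarith

theorem Multiset.prod_map_lt_prod_map_of_pos {α : Type*} {s : Multiset α} (hs : s ≠ 0)
    {u v : α → ℝ} (hu : ∀ x ∈ s, 0 ≤ u x) (huv : ∀ x ∈ s, u x < v x) :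
    (s.map u).prod < (s.map v).prod := by
  induction s using Multiset.induction with
  | empty => exact absurd rfl hs
  | cons x s ih =>
    have hx : u x < v x := huv x (Multiset.mem_cons_self x s)
    have hx0 : 0 ≤ u x := hu x (Multiset.mem_cons_self x s)
    rw [Multiset.map_cons, Multiset.map_cons, Multiset.prod_cons, Multiset.prod_cons]
    rcases eq_or_ne s 0 with rfl | hs0
    · simpa using hx
    · have hlt := ih hs0 (fun y hy => hu y (Multiset.mem_cons_of_mem hy))
        (fun y hy => huv y (Multiset.mem_cons_of_mem hy))
      refine mul_lt_mul'' hx hlt hx0 (Multiset.prod_nonneg fun y hy => ?_)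
      obtain ⟨w, hw, rfl⟩ := Multiset.mem_map.mp hy
      exact hu w (Multiset.mem_cons_of_mem hw)

/-- If all complex roots of a nonconstant `g` are closer to `a` than to `b`,
then `|g(a)| < |g(b)|`. -/
theorem natAbs_eval_lt_natAbs_eval {g : ℤ[X]} (hg : 0 < g.natDegree) {a b : ℤ}
    (h : ∀ z : ℂ, aeval z g = 0 → ‖(a : ℂ) - z‖ < ‖(b : ℂ) - z‖) :
    (g.eval a).natAbs < (g.eval b).natAbs := by
  have hg0 : g ≠ 0 := ne_zero_of_natDegree_gt hg
  have hinj : Function.Injective (Int.castRingHom ℂ) := (Int.castRingHom ℂ).injective_int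
  set P : ℂ[X] := g.map (Int.castRingHom ℂ) with hP
  have hP0 : P ≠ 0 := (Polynomial.map_ne_zero_iff hinj).mpr hg0
  have hsplit : P.Splits := IsAlgClosed.splits P
  have hroots : P.roots ≠ 0 := by
    rw [← Multiset.card_pos, ← hsplit.natDegree_eq_card_roots, hP,
      natDegree_map_eq_of_injective hinj]
    exact hg
  have hval (c : ℤ) : ((g.eval c).natAbs : ℝ) =
      ‖P.leadingCoeff‖ * (P.roots.map fun z => ‖(c : ℂ) - z‖).prod := by
    have h1 : ((g.eval c : ℤ) : ℂ) = P.eval (c : ℂ) := by simp [hP]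
    have h2 : ((g.eval c).natAbs : ℝ) = ‖((g.eval c : ℤ) : ℂ)‖ := by
      rw [Nat.cast_natAbs, Complex.norm_intCast, Int.cast_abs]
    rw [h2, h1, hsplit.eval_eq_prod_roots, norm_mul]
    congr 1
    simpa [Multiset.map_map] using
      map_multiset_prod (normHom : ℂ →*₀ ℝ) (P.roots.map fun z => (c : ℂ) - z)
  have hlt : ((g.eval a).natAbs : ℝ) < (g.eval b).natAbs := by
    rw [hval, hval]
    refine mul_lt_mul_of_pos_left ?_ (norm_pos_iff.mpr (leadingCoeff_ne_zero.mpr hP0))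
    refine Multiset.prod_map_lt_prod_map_of_pos hroots (fun _ _ => norm_nonneg _) fun z hz => h z ?_
    have := (mem_roots hP0).mp hz
    rwa [IsRoot.def, hP, eval_map, ← algebraMap_int_eq, ← aeval_def] at this
  exact_mod_cast hlt

/-- A nonconstant integer polynomial without a factorization into nonconstant integer
polynomials is irreducible over `ℚ`. -/
theorem irreducible_map_rat_of_forall_factor {f : ℤ[X]} (hdeg : 0 < f.natDegree)
    (h : ∀ g q : ℤ[X], f = g * q → 0 < g.natDegree → 0 < q.natDegree → False) :
    Irreducible (f.map (Int.castRingHom ℚ)) := by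
  have hf0 : f ≠ 0 := ne_zero_of_natDegree_gt hdeg
  have hc : f.content ≠ 0 := content_eq_zero_iff.not.mpr hf0
  have hprim := f.isPrimitive_primPart
  have hunit (g q : ℤ[X]) (hgq : f.primPart = g * q) (hg : g.natDegree = 0) : IsUnit g := by
    rw [eq_C_of_natDegree_eq_zero hg] at hgq ⊢
    exact isUnit_C.mpr (hprim _ (hgq ▸ dvd_mul_right _ _))
  have hirr : Irreducible f.primPart := by
    refine ⟨fun hu => ?_, fun g q hgq => ?_⟩
    · have := natDegree_eq_zero_of_isUnit hu
      rw [natDegree_primPart] at this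
      omega
    · by_contra! hcon
      have hg : g.natDegree ≠ 0 := fun h0 => hcon.1 (hunit g q hgq h0)
      have hq : q.natDegree ≠ 0 := fun h0 => hcon.2 (hunit q g (hgq.trans (mul_comm g q)) h0)
      refine h (C f.content * g) q ?_ ?_ (Nat.pos_of_ne_zero hq)
      · rw [mul_assoc, ← hgq]
        exact f.eq_C_content_mul_primPart
      · rw [natDegree_C_mul hc]
        exact Nat.pos_of_ne_zero hg
  rw [IsPrimitive.Int.irreducible_iff_irreducible_map_cast hprim] at hirr
  rw [f.eq_C_content_mul_primPart, Polynomial.map_mul, map_C]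
  refine (irreducible_isUnit_mul (isUnit_C.mpr ?_)).mpr hirr
  simpa using hc

theorem Nat.Prime.exists_pow_mul_pow_of_mul_eq_pow {p m n k : ℕ} (hp : p.Prime)
    (h : m * n = p ^ k) : ∃ u v, m = p ^ u ∧ n = p ^ v ∧ u + v = k := by
  obtain ⟨u, -, rfl⟩ := (Nat.dvd_prime_pow hp).mp (Dvd.intro _ h)
  obtain ⟨v, -, rfl⟩ := (Nat.dvd_prime_pow hp).mp (Dvd.intro_left _ h)
  exact ⟨u, v, rfl, rfl, Nat.pow_right_injective hp.two_le (by simpa [pow_add] using h)⟩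

theorem Nat.Prime.not_lt_of_mul_eq_pow_mul_of_mul_eq_pow_succ {p k r A B C D : ℕ} (hp : p.Prime)
    (hr : 0 < r) (hAB : A * B = p ^ k * r) (hCD : C * D = p ^ (k + 1)) (hAC : A < C) :
    ¬ B < D := by
  intro hBD
  have hAB0 : 0 < A * B := hAB ▸ Nat.mul_pos (pow_pos hp.pos k) hr
  obtain ⟨x, y, hx, hy, hxy⟩ := exists_dvd_and_dvd_of_dvd_mul (Dvd.intro _ hAB.symm)
  obtain ⟨u, v, rfl, rfl, huv⟩ := hp.exists_pow_mul_pow_of_mul_eq_pow hxy.symm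
  obtain ⟨s, t, rfl, rfl, hst⟩ := hp.exists_pow_mul_pow_of_mul_eq_pow hCD
  have hus := (Nat.pow_lt_pow_iff_right hp.one_lt).mp
    ((Nat.le_of_dvd (Nat.pos_of_mul_pos_right hAB0) hx).trans_lt hAC)
  have hvt := (Nat.pow_lt_pow_iff_right hp.one_lt).mp
    ((Nat.le_of_dvd (Nat.pos_of_mul_pos_left hAB0) hy).trans_lt hBD)
  omega

theorem Nat.Prime.not_lt_of_mul_eq_pow_of_mul_eq_pow_mul {p r k A B C D : ℕ} (hp : p.Prime)
    (hr : r.Prime) (hrp : r < p) (hAB : A * B = p ^ k) (hCD : C * D = p ^ k * r) (hAC : A < C) :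
    ¬ B < D := by
  intro hBD
  wlog hrC : r ∣ C generalizing A B C D
  · have hrD := (hr.dvd_mul.mp (Dvd.intro_left _ hCD.symm)).resolve_left hrC
    exact this (mul_comm A B ▸ hAB) (mul_comm C D ▸ hCD) hBD hAC hrD
  obtain ⟨E, rfl⟩ := hrC
  have hED : E * D = p ^ k := by
    refine Nat.eq_of_mul_eq_mul_left hr.pos ?_
    rw [← mul_assoc, hCD, mul_comm]
  obtain ⟨u, v, rfl, rfl, huv⟩ := hp.exists_pow_mul_pow_of_mul_eq_pow hAB
  obtain ⟨s, t, rfl, rfl, hst⟩ := hp.exists_pow_mul_pow_of_mul_eq_pow hED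
  have hvt := (Nat.pow_lt_pow_iff_right hp.one_lt).mp hBD
  have hus : u < s + 1 := by
    refine (Nat.pow_lt_pow_iff_right hp.one_lt).mp (hAC.trans ?_)
    rw [pow_succ, mul_comm]
    exact Nat.mul_lt_mul_of_pos_left hrp (pow_pos hp.pos s)
  omega

theorem statement_6 (f : Polynomial ℤ) (hdeg : 1 ≤ f.natDegree) (a b : ℤ)
    (hab : a ^ 2 < b ^ 2)
    (hlead : ((|f.leadingCoeff| : ℤ) : ℝ) >
      ∑ i ∈ Finset.range f.natDegree,
        ((|f.coeff i| : ℤ) : ℝ) * (((|a + b| : ℤ) : ℝ) / 2) ^ ((i : ℤ) - (f.natDegree : ℤ)))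
    (hcase :
      (∃ p : ℕ, p.Prime ∧ ∃ (k : ℕ) (r : ℤ), 0 < r ∧ r < (p : ℤ) ∧
        |f.eval a| = (p : ℤ) ^ k * r ∧ |f.eval b| = (p : ℤ) ^ (k + 1)) ∨
      (∃ p r : ℕ, p.Prime ∧ r.Prime ∧ r < p ∧ ∃ k : ℕ, 1 ≤ k ∧
        |f.eval a| = (p : ℤ) ^ k ∧ |f.eval b| = (p : ℤ) ^ k * (r : ℤ))) :
    Irreducible (Polynomial.map (Int.castRingHom ℚ) f) := by
  have hsum : a + b ≠ 0 := fun h0 => by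
    rw [eq_neg_of_add_eq_zero_left h0, neg_sq] at hab
    exact hab.false
  have hR : 0 < ((|a + b| : ℤ) : ℝ) / 2 := by
    have := Int.cast_pos (R := ℝ).mpr (abs_pos.mpr hsum)
    linarith
  have hcloser (z : ℂ) (hz : aeval z f = 0) : ‖(a : ℂ) - z‖ < ‖(b : ℂ) - z‖ := by
    have hlt := norm_lt_of_leadingCoeff_dominant hR hlead hz
    have habR : (a : ℝ) ^ 2 < (b : ℝ) ^ 2 := by exact_mod_cast hab
    simpa using norm_sub_lt_norm_sub_of_norm_lt habR (by simpa using hlt)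
  refine irreducible_map_rat_of_forall_factor hdeg fun g q hgq hg hq => ?_
  have hlt_g := natAbs_eval_lt_natAbs_eval hg fun z hz => hcloser z (by simp [hgq, hz])
  have hlt_q := natAbs_eval_lt_natAbs_eval hq fun z hz => hcloser z (by simp [hgq, hz])
  have hmul (c : ℤ) : (((g.eval c).natAbs * (q.eval c).natAbs : ℕ) : ℤ) = |f.eval c| := by
    rw [hgq, eval_mul, ← Int.natAbs_mul, Int.natCast_natAbs]
  rcases hcase with ⟨p, hp, k, r, hr, -, ha, hb⟩ | ⟨p, r, hp, hr, hrp, k, -, ha, hb⟩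
  · lift r to ℕ using hr.le
    rw [← hmul] at ha hb
    exact hp.not_lt_of_mul_eq_pow_mul_of_mul_eq_pow_succ (by exact_mod_cast hr)
      (by exact_mod_cast ha) (by exact_mod_cast hb) hlt_g hlt_q
  · rw [← hmul] at ha hb
    exact hp.not_lt_of_mul_eq_pow_of_mul_eq_pow_mul hr hrp
      (by exact_mod_cast ha) (by exact_mod_cast hb) hlt_g hlt_q
end

section
/- Let f(X) = a_0 + a_1 X + ... + a_n X^n be a polynomial with integer coefficients of degree n ≥ 1, with |a_n| > 2|a_{n−1}| + 2²|a_{n−2}| + ... + 2^n|a_0| and a_0 ≠ 0. If there exists a non-zero integer b such that |f(b)| is a prime number, then f is irreducible over ℚ. -/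
open Polynomial

/-- A complex polynomial each of whose roots is nearer to `0` than to `b` takes a value at `b` of
larger modulus than at `0`. -/
theorem norm_eval_zero_lt_norm_eval (P : ℂ[X]) (hP : 0 < P.natDegree) (b : ℂ)
    (hroot : ∀ z ∈ P.roots, ‖z‖ < ‖b - z‖) : ‖P.eval 0‖ < ‖P.eval b‖ := by
  have hsplit : P.Splits := IsAlgClosed.splits P
  have hlc : 0 < ‖P.leadingCoeff‖ := by
    rw [norm_pos_iff, leadingCoeff_ne_zero]
    rintro rfl
    simp at hP
  have hprod : ∀ s : Multiset ℂ, s ≠ 0 → (∀ z ∈ s, ‖z‖ < ‖b - z‖) →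
      ‖(s.map (0 - ·)).prod‖ < ‖(s.map (b - ·)).prod‖ := by
    intro s
    induction s using Multiset.induction_on with
    | empty => simp
    | cons a s ih =>
      intro _ h
      have ha := h a (Multiset.mem_cons_self a s)
      simp only [Multiset.map_cons, Multiset.prod_cons, norm_mul, zero_sub, norm_neg] at ih ⊢
      by_cases hs : s = 0
      · simpa [hs] using ha
      · exact mul_lt_mul'' ha (ih hs fun z hz => h z (Multiset.mem_cons_of_mem hz))
          (norm_nonneg _) (norm_nonneg _)
  have hne : P.roots ≠ 0 := by
    rw [← Multiset.card_pos, ← hsplit.natDegree_eq_card_roots]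
    exact hP
  rw [hsplit.eval_eq_prod_roots, hsplit.eval_eq_prod_roots, norm_mul, norm_mul]
  exact mul_lt_mul_of_pos_left (hprod _ hne hroot) hlc

/-- If the leading coefficient strictly dominates the other ones weighted by powers of two, then
all complex roots lie in the open disc of radius `1 / 2`. -/
theorem norm_root_lt_half (f : ℤ[X])
    (hlead : |f.leadingCoeff| >
      ∑ i ∈ Finset.range f.natDegree, 2 ^ (f.natDegree - i) * |f.coeff i|)
    (z : ℂ) (hz : aeval z f = 0) : ‖z‖ < 1 / 2 := by
  by_contra! hge
  have hpos : 0 < ‖z‖ := by linarith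
  rw [aeval_eq_sum_range, Finset.sum_range_succ, add_comm, add_eq_zero_iff_eq_neg] at hz
  have hle : |(f.leadingCoeff : ℝ)| * ‖z‖ ^ f.natDegree ≤
      ∑ i ∈ Finset.range f.natDegree, |(f.coeff i : ℝ)| * ‖z‖ ^ i := by
    have h := congrArg norm hz
    rw [norm_neg] at h
    calc |(f.leadingCoeff : ℝ)| * ‖z‖ ^ f.natDegree
        = ‖∑ i ∈ Finset.range f.natDegree, f.coeff i • z ^ i‖ := by
          rw [← h]; simp [zsmul_eq_mul]
      _ ≤ _ := (norm_sum_le _ _).trans (le_of_eq (by simp [zsmul_eq_mul]))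
  have hlt : (∑ i ∈ Finset.range f.natDegree,
      (2 : ℝ) ^ (f.natDegree - i) * |(f.coeff i : ℝ)|) < |(f.leadingCoeff : ℝ)| := by
    exact_mod_cast hlead
  have hsum : ∑ i ∈ Finset.range f.natDegree, |(f.coeff i : ℝ)| * ‖z‖ ^ i ≤
      (∑ i ∈ Finset.range f.natDegree, (2 : ℝ) ^ (f.natDegree - i) * |(f.coeff i : ℝ)|) *
        ‖z‖ ^ f.natDegree := by
    rw [Finset.sum_mul]
    refine Finset.sum_le_sum fun i hi => ?_
    have hi' : f.natDegree - i + i = f.natDegree :=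
      Nat.sub_add_cancel (Finset.mem_range.mp hi).le
    have hone : 1 ≤ (2 * ‖z‖) ^ (f.natDegree - i) := one_le_pow₀ (by linarith)
    calc |(f.coeff i : ℝ)| * ‖z‖ ^ i
        ≤ (|(f.coeff i : ℝ)| * ‖z‖ ^ i) * (2 * ‖z‖) ^ (f.natDegree - i) :=
          le_mul_of_one_le_right (by positivity) hone
      _ = 2 ^ (f.natDegree - i) * |(f.coeff i : ℝ)| * ‖z‖ ^ (f.natDegree - i + i) := by
          rw [mul_pow, pow_add]; ring
      _ = _ := by rw [hi']
  have := mul_lt_mul_of_pos_right hlt (pow_pos hpos f.natDegree)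
  linarith

/-- An integer polynomial whose complex roots lie in the open disc of radius `1 / 2`, with non-zero
constant coefficient, is constant as soon as it takes a unit value at a non-zero integer. -/
theorem natDegree_eq_zero_of_isUnit_eval (g : ℤ[X]) (h0 : g.coeff 0 ≠ 0)
    (hroot : ∀ z : ℂ, aeval z g = 0 → ‖z‖ < 1 / 2) (b : ℤ) (hb : b ≠ 0)
    (hu : IsUnit (g.eval b)) : g.natDegree = 0 := by
  by_contra hdeg
  have hinj : Function.Injective (Int.castRingHom ℂ) := Int.cast_injective
  have hlt := norm_eval_zero_lt_norm_eval (g.map (Int.castRingHom ℂ))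
    (by rw [natDegree_map_eq_of_injective hinj]; exact Nat.pos_of_ne_zero hdeg) (b : ℂ) (by
      intro z hz
      have hz' : ‖z‖ < 1 / 2 := hroot z (by
        have := (mem_roots'.mp hz).2
        rwa [IsRoot, eval_map, ← algebraMap_int_eq, ← aeval_def] at this)
      have hb1 : (1 : ℝ) ≤ ‖(b : ℂ)‖ := by
        rw [Complex.norm_intCast]
        exact_mod_cast Int.one_le_abs hb
      linarith [norm_sub_norm_le (b : ℂ) z])
  rw [eval_intCast_map, ← coeff_zero_eq_eval_zero, coeff_map, eq_intCast, eq_intCast,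
    Complex.norm_intCast, Complex.norm_intCast] at hlt
  have hlt' : |g.coeff 0| < |g.eval b| := by exact_mod_cast hlt
  rw [Int.isUnit_iff_abs_eq.mp hu] at hlt'
  exact absurd (Int.one_le_abs h0) (not_le.mpr hlt')

theorem statement_7 (f : Polynomial ℤ) (hdeg : 1 ≤ f.natDegree)
    (hlead : |f.leadingCoeff| >
      ∑ i ∈ Finset.range f.natDegree, 2 ^ (f.natDegree - i) * |f.coeff i|)
    (h0 : f.coeff 0 ≠ 0)
    (hb : ∃ b : ℤ, b ≠ 0 ∧ Nat.Prime (f.eval b).natAbs) :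
    Irreducible (Polynomial.map (Int.castRingHom ℚ) f) := by
  obtain ⟨b, hb0, hp⟩ := hb
  have hirr : Irreducible (f.eval b) := (Int.prime_iff_natAbs_prime.mpr hp).irreducible
  have hconst : ∀ g : ℤ[X], g ∣ f → IsUnit (g.eval b) → g.natDegree = 0 := by
    rintro g ⟨h, rfl⟩ hu
    refine natDegree_eq_zero_of_isUnit_eval g ?_ (fun z hz => ?_) b hb0 hu
    · rw [mul_coeff_zero] at h0
      exact left_ne_zero_of_mul h0
    · exact norm_root_lt_half _ hlead z (by rw [map_mul, hz, zero_mul])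
  have hprim := f.isPrimitive_primPart
  have hunit : ∀ g : ℤ[X], g ∣ f.primPart → IsUnit (g.eval b) → IsUnit g := by
    intro g hg hu
    have hgC := eq_C_of_natDegree_eq_zero (hconst g (hg.trans f.primPart_dvd) hu)
    rw [hgC] at hg ⊢
    exact isUnit_C.mpr (isPrimitive_iff_isUnit_of_C_dvd.mp hprim _ hg)
  have hmul : f.eval b = f.content * f.primPart.eval b := by
    conv_lhs => rw [f.eq_C_content_mul_primPart, eval_mul, eval_C]
  have hcontent : IsUnit f.content := by
    refine (hirr.isUnit_or_isUnit hmul).resolve_right fun hu => ?_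
    have := hconst _ f.primPart_dvd hu
    rw [natDegree_primPart] at this
    omega
  have hpp : Irreducible f.primPart := by
    refine ⟨fun hu => ?_, fun g h hgh => ?_⟩
    · have := natDegree_eq_zero_of_isUnit hu
      rw [natDegree_primPart] at this
      omega
    · rw [hgh, eval_mul, ← mul_assoc] at hmul
      rcases hirr.isUnit_or_isUnit hmul with hu | hu
      · exact .inl (hunit g ⟨h, hgh⟩ (isUnit_of_mul_isUnit_right hu))
      · exact .inr (hunit h ⟨g, hgh.trans (mul_comm _ _)⟩ hu)
  have hfirr : Irreducible f := by
    rw [f.eq_C_content_mul_primPart]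
    exact (irreducible_isUnit_mul (isUnit_C.mpr hcontent)).mpr hpp
  have hfprim : f.IsPrimitive := hfirr.isPrimitive (by omega)
  exact (IsPrimitive.Int.irreducible_iff_irreducible_map_cast hfprim).mp hfirr
end

section
/- Let f(X) = a_0 + a_1 X + ... + a_n X^n be an Eneström–Kakeya polynomial of degree n ≥ 1 with integer coefficients and a_0 ≠ 0. If f(−1) ≠ 0 and |f(b)| is a prime number for some integer b with |b| ≥ 2, then f is irreducible over ℚ. -/
open Polynomial

/-- Summation by parts for a nonnegative nondecreasing coefficient sequence. -/
lemma norm_sub_one_mul_sum_sub_le (a : ℕ → ℝ) (n : ℕ) (h0 : 0 ≤ a 0)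
    (hmono : ∀ i < n, a i ≤ a (i + 1)) (z : ℂ) (hz : 1 ≤ ‖z‖) :
    0 ≤ a n ∧
      ‖(z - 1) * ∑ i ∈ Finset.range (n + 1), (a i : ℂ) * z ^ i - a n * z ^ (n + 1)‖
        ≤ a n * ‖z‖ ^ n := by
  induction n with
  | zero =>
    refine ⟨h0, ?_⟩
    have : (z - 1) * (a 0 : ℂ) - a 0 * z = -(a 0 : ℂ) := by ring
    simp [this, abs_of_nonneg h0]
  | succ n ih =>
    obtain ⟨hn, hb⟩ := ih fun i hi => hmono i (by omega)
    have hstep := hmono n (by omega)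
    refine ⟨hn.trans hstep, ?_⟩
    rw [Finset.sum_range_succ]
    have key : (z - 1) * (∑ i ∈ Finset.range (n + 1), (a i : ℂ) * z ^ i
          + (a (n + 1) : ℂ) * z ^ (n + 1)) - a (n + 1) * z ^ (n + 1 + 1)
        = ((z - 1) * ∑ i ∈ Finset.range (n + 1), (a i : ℂ) * z ^ i - a n * z ^ (n + 1))
          - ((a (n + 1) - a n : ℝ) : ℂ) * z ^ (n + 1) := by
      push_cast
      ring
    rw [key]
    refine (norm_sub_le _ _).trans ?_
    rw [norm_mul, norm_pow, Complex.norm_real, Real.norm_of_nonneg (sub_nonneg.2 hstep)]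
    have : a n * ‖z‖ ^ n ≤ a n * ‖z‖ ^ (n + 1) :=
      mul_le_mul_of_nonneg_left (pow_le_pow_right₀ hz n.le_succ) hn
    linarith

/-- The Eneström–Kakeya theorem for integer polynomials. -/
lemma norm_le_one_of_aeval_eq_zero (f : ℤ[X]) (h0 : 0 ≤ f.coeff 0)
    (hmono : ∀ i < f.natDegree, f.coeff i ≤ f.coeff (i + 1)) (hf : f ≠ 0)
    {z : ℂ} (hz : aeval z f = 0) : ‖z‖ ≤ 1 := by
  by_contra! h
  obtain ⟨hn, hb⟩ := norm_sub_one_mul_sum_sub_le (fun i => (f.coeff i : ℝ)) f.natDegree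
    (by exact_mod_cast h0) (fun i hi => by exact_mod_cast hmono i hi) z h.le
  have hsum : ∑ i ∈ Finset.range (f.natDegree + 1), (((f.coeff i : ℤ) : ℝ) : ℂ) * z ^ i = 0 := by
    rw [aeval_eq_sum_range] at hz
    simpa [zsmul_eq_mul] using hz
  have hlead : (f.coeff f.natDegree : ℝ) ≠ 0 := by
    exact_mod_cast leadingCoeff_ne_zero.2 hf
  have hpos := lt_of_le_of_ne hn hlead.symm
  rw [hsum, mul_zero, zero_sub, norm_neg, norm_mul, norm_pow, Complex.norm_real,
    Real.norm_of_nonneg hn] at hb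
  have := le_of_mul_le_mul_left hb hpos
  exact absurd this (not_le.2 (pow_lt_pow_right₀ h (Nat.lt_succ_self _)))

lemma eval_one_pos (f : ℤ[X]) (h0 : 0 < f.coeff 0)
    (hmono : ∀ i < f.natDegree, f.coeff i ≤ f.coeff (i + 1)) : 0 < f.eval 1 := by
  have hpos : ∀ i ≤ f.natDegree, 0 < f.coeff i := by
    intro i
    induction i with
    | zero => exact fun _ => h0
    | succ i ih => exact fun hi => (ih (by omega)).trans_le (hmono i (by omega))
  rw [eval_eq_sum_range]
  refine Finset.sum_pos (fun i hi => ?_) (by simp)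
  simpa using hpos i (by simpa [Nat.lt_succ_iff] using hi)

/-- Points of the closed unit disc other than `±1` are at distance more than `1` from every
integer of absolute value at least `2`. -/
lemma one_lt_norm_intCast_sub {b : ℤ} (hb : 2 ≤ |b|) {z : ℂ} (hz : ‖z‖ ≤ 1) (h1 : z ≠ 1)
    (hm1 : z ≠ -1) : 1 < ‖(b : ℂ) - z‖ := by
  by_contra! h
  have hz' : z.re * z.re + z.im * z.im ≤ 1 := by
    rw [← Complex.normSq_apply, Complex.normSq_eq_norm_sq]
    exact pow_le_one₀ (norm_nonneg _) hz
  have h' : ((b : ℝ) - z.re) * (b - z.re) + z.im * z.im ≤ 1 := by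
    have := pow_le_one₀ (n := 2) (norm_nonneg _) h
    rw [← Complex.normSq_eq_norm_sq, Complex.normSq_apply] at this
    simpa using this
  rcases le_abs.1 hb with hb | hb
  · have hb' : (2 : ℝ) ≤ b := by exact_mod_cast hb
    have hre : z.re = 1 := by nlinarith [mul_self_nonneg z.im]
    have him : z.im = 0 := by nlinarith
    exact h1 (Complex.ext (by simpa using hre) (by simpa using him))
  · have hb' : (2 : ℝ) ≤ -b := by exact_mod_cast hb
    have hre : z.re = -1 := by nlinarith [mul_self_nonneg z.im]
    have him : z.im = 0 := by nlinarith
    exact hm1 (Complex.ext (by simpa using hre) (by simpa using him))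

lemma one_le_norm_multiset_prod {s : Multiset ℂ} (hs : ∀ x ∈ s, 1 ≤ ‖x‖) : 1 ≤ ‖s.prod‖ := by
  induction s using Multiset.induction with
  | empty => simp
  | cons a s ih =>
    rw [Multiset.prod_cons, norm_mul]
    exact one_le_mul_of_one_le_of_one_le (hs a (Multiset.mem_cons_self a s))
      (ih fun x hx => hs x (Multiset.mem_cons_of_mem hx))

/-- An integer polynomial all of whose complex roots are at distance more than `1` from `b` takes a
value of absolute value `1` at `b` only if it is a unit. -/
lemma isUnit_of_natAbs_eval_eq_one {g : ℤ[X]} {b : ℤ}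
    (hroots : ∀ z : ℂ, aeval z g = 0 → 1 < ‖(b : ℂ) - z‖) (hg : (g.eval b).natAbs = 1) :
    IsUnit g := by
  have hg0 : g ≠ 0 := by
    rintro rfl
    simp at hg
  set p : ℂ[X] := g.map (Int.castRingHom ℂ) with hp
  have hinj : Function.Injective (Int.castRingHom ℂ) := Int.cast_injective
  have hp0 : p ≠ 0 := (Polynomial.map_ne_zero_iff hinj).2 hg0
  have heval : p.eval (b : ℂ) = ((g.eval b : ℤ) : ℂ) := by
    rw [hp]
    exact eval_intCast_map (Int.castRingHom ℂ) g b
  have hnorm : ‖p.eval (b : ℂ)‖ = 1 := by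
    rw [heval, Complex.norm_intCast, ← Int.cast_abs, Int.abs_eq_natAbs, hg]
    simp
  have hlead : 1 ≤ ‖p.leadingCoeff‖ := by
    rw [hp, leadingCoeff_map_of_injective hinj, eq_intCast, Complex.norm_intCast]
    exact_mod_cast Int.one_le_abs (leadingCoeff_ne_zero.2 hg0)
  have hsplit := IsAlgClosed.splits p
  have hdist : ∀ z ∈ p.roots, 1 < ‖(b : ℂ) - z‖ := fun z hz => hroots z (by
    have := (mem_roots hp0).1 hz
    rwa [IsRoot, hp, eval_map] at this)
  have hnat : g.natDegree = 0 := by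
    by_contra hne
    have hr : p.roots ≠ 0 := by
      intro h
      have := hsplit.natDegree_eq_card_roots
      rw [h, hp, natDegree_map_eq_of_injective hinj] at this
      exact hne (by simpa using this)
    obtain ⟨z, hz⟩ := Multiset.exists_mem_of_ne_zero hr
    obtain ⟨s, hs⟩ := Multiset.exists_cons_of_mem hz
    rw [hsplit.eval_eq_prod_roots, hs, Multiset.map_cons, Multiset.prod_cons, norm_mul, norm_mul]
      at hnorm
    have hrest : 1 ≤ ‖(s.map fun a => (b : ℂ) - a).prod‖ := by
      refine one_le_norm_multiset_prod fun x hx => ?_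
      obtain ⟨a, ha, rfl⟩ := Multiset.mem_map.1 hx
      exact (hdist a (hs ▸ Multiset.mem_cons_of_mem ha)).le
    exact (one_lt_mul_of_le_of_lt hlead
      (one_lt_mul_of_lt_of_le (hdist z hz) hrest)).ne' hnorm
  rw [eq_C_of_natDegree_eq_zero hnat] at hg ⊢
  rw [eval_C] at hg
  exact isUnit_C.2 (Int.isUnit_iff_natAbs_eq.2 hg)

theorem statement_9 (f : Polynomial ℤ) (hdeg : 1 ≤ f.natDegree)
    (hEK0 : 0 ≤ f.coeff 0)
    (hEKmono : ∀ i < f.natDegree, f.coeff i ≤ f.coeff (i + 1))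
    (h0 : f.coeff 0 ≠ 0)
    (hm1 : f.eval (-1) ≠ 0)
    (hb : ∃ b : ℤ, 2 ≤ |b| ∧ Nat.Prime (f.eval b).natAbs) :
    Irreducible (Polynomial.map (Int.castRingHom ℚ) f) := by
  obtain ⟨b, hb2, hprime⟩ := hb
  have hf0 : f ≠ 0 := by
    rintro rfl
    simp at h0
  have hone := eval_one_pos f (lt_of_le_of_ne hEK0 h0.symm) hEKmono
  have hroots : ∀ z : ℂ, aeval z f = 0 → 1 < ‖(b : ℂ) - z‖ := by
    intro z hz
    refine one_lt_norm_intCast_sub hb2 (norm_le_one_of_aeval_eq_zero f hEK0 hEKmono hf0 hz) ?_ ?_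
    · rintro rfl
      have : aeval (1 : ℂ) f = ((f.eval 1 : ℤ) : ℂ) := by
        simpa using aeval_algebraMap_apply_eq_algebraMap_eval (A := ℂ) (1 : ℤ) f
      exact hone.ne' (by exact_mod_cast this.symm.trans hz)
    · rintro rfl
      have : aeval (-1 : ℂ) f = ((f.eval (-1) : ℤ) : ℂ) := by
        simpa using aeval_algebraMap_apply_eq_algebraMap_eval (A := ℂ) (-1 : ℤ) f
      exact hm1 (by exact_mod_cast this.symm.trans hz)
  have hunit : ∀ g : ℤ[X], g ∣ f → (g.eval b).natAbs = 1 → IsUnit g := by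
    rintro g ⟨h, rfl⟩ hg
    exact isUnit_of_natAbs_eval_eq_one (fun z hz => hroots z (by simp [hz])) hg
  have hirr : Irreducible f.primPart := by
    refine ⟨fun hu => ?_, fun g h hgh => ?_⟩
    · have := natDegree_eq_zero_of_isUnit hu
      rw [natDegree_primPart] at this
      omega
    · have hg : g ∣ f := (Dvd.intro _ hgh.symm).trans f.primPart_dvd
      have hh : h ∣ f := (Dvd.intro_left _ hgh.symm).trans f.primPart_dvd
      have hdvd : (g.eval b).natAbs * (h.eval b).natAbs ∣ (f.eval b).natAbs := by
        rw [← Int.natAbs_mul, ← eval_mul, ← hgh]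
        exact Int.natAbs_dvd_natAbs.2 (eval_dvd f.primPart_dvd)
      rcases (Nat.dvd_prime hprime).1 hdvd with h1 | h1
      · exact Or.inl (hunit g hg (Nat.eq_one_of_mul_eq_one_right h1))
      · rcases Nat.prime_mul_iff.1 (h1 ▸ hprime) with h2 | h2
        · exact Or.inr (hunit h hh h2.2)
        · exact Or.inl (hunit g hg h2.2)
  have hmap := (IsPrimitive.Int.irreducible_iff_irreducible_map_cast f.isPrimitive_primPart).1 hirr
  have hc : IsUnit (C ((f.content : ℤ) : ℚ)) :=
    isUnit_C.2 (isUnit_iff_ne_zero.2 (by exact_mod_cast mt content_eq_zero_iff.1 hf0))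
  have hfac : f.map (Int.castRingHom ℚ)
      = C ((f.content : ℤ) : ℚ) * f.primPart.map (Int.castRingHom ℚ) := by
    conv_lhs => rw [f.eq_C_content_mul_primPart]
    simp [Polynomial.map_mul]
  rw [hfac]
  exact (irreducible_isUnit_mul hc).2 hmap
end

section
/- Let f(X) = a_0 + a_1 X + ... + a_n X^n be a polynomial with integer coefficients of degree n ≥ 1, and let a, b be integers with 0 < |f(a)| < |f(b)|, gcd(f(a), f'(a)) = 1 and gcd(f(b), f'(b)) = 1. Let q_u = max { d_2/d_1 ≤ √(|f(b)|/|f(a)|) : d_1 a unitary divisor of f(a), d_2 a unitary divisor of f(b) }, and assume q_u = 1. If b > a and every complex root of f has real part strictly less than (a+b)/2, or if a > b and every complex root of f has real part strictly greater than (a+b)/2, then f is irreducible over ℚ. -/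
open Polynomial

/-- `d` is a unitary divisor of `f(a)`: `d ∣ f(a)` and `gcd(d, f(a)/d) = 1`. -/
def UnitaryDivisor (f : Polynomial ℤ) (a d : ℤ) : Prop :=
  d ∣ f.eval a ∧ Int.gcd d (f.eval a / d) = 1

/-- The set of quotients `d₂/d₁` of unitary divisors of `f(a)` and `f(b)`
that do not exceed `√(|f(b)|/|f(a)|)`. -/
def unitaryQuotients (f : Polynomial ℤ) (a b : ℤ) : Set ℝ :=
  {x : ℝ | ∃ d₁ d₂ : ℤ, UnitaryDivisor f a d₁ ∧ UnitaryDivisor f b d₂ ∧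
    x = (d₂ : ℝ) / (d₁ : ℝ) ∧
    x ≤ Real.sqrt (((|f.eval b| : ℤ) : ℝ) / ((|f.eval a| : ℤ) : ℝ))}

theorem multiset_prod_map_le_and_pos {α : Type*} (u v : α → ℝ) (s : Multiset α)
    (hu : ∀ x ∈ s, 0 ≤ u x) (huv : ∀ x ∈ s, u x < v x) :
    0 ≤ (s.map u).prod ∧ (s.map u).prod ≤ (s.map v).prod ∧ 0 < (s.map v).prod := by
  induction s using Multiset.induction_on with
  | empty => simp
  | cons c s ih =>
    obtain ⟨h0, h1, h2⟩ := ih (fun x hx => hu x (Multiset.mem_cons_of_mem hx))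
      (fun x hx => huv x (Multiset.mem_cons_of_mem hx))
    have hc := hu c (Multiset.mem_cons_self c s)
    have hcv := huv c (Multiset.mem_cons_self c s)
    simp only [Multiset.map_cons, Multiset.prod_cons]
    exact ⟨mul_nonneg hc h0, mul_le_mul hcv.le h1 h0 (hc.trans hcv.le),
      mul_pos (hc.trans_lt hcv) h2⟩

theorem multiset_prod_map_lt {α : Type*} (u v : α → ℝ) (s : Multiset α) (hs : s ≠ 0)
    (hu : ∀ x ∈ s, 0 ≤ u x) (huv : ∀ x ∈ s, u x < v x) :
    (s.map u).prod < (s.map v).prod := by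
  obtain ⟨c, hc⟩ := Multiset.exists_mem_of_ne_zero hs
  obtain ⟨t, rfl⟩ := Multiset.exists_cons_of_mem hc
  obtain ⟨-, h1, h2⟩ := multiset_prod_map_le_and_pos u v t
    (fun x hx => hu x (Multiset.mem_cons_of_mem hx))
    (fun x hx => huv x (Multiset.mem_cons_of_mem hx))
  simp only [Multiset.map_cons, Multiset.prod_cons]
  exact mul_lt_mul_of_lt_of_le_of_nonneg_of_pos (huv c hc) h1 (hu c hc) h2

theorem norm_eval_eq_prod_roots (p : ℂ[X]) (x : ℂ) :
    ‖p.eval x‖ = ‖p.leadingCoeff‖ * (p.roots.map fun θ => ‖x - θ‖).prod := by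
  rw [(IsAlgClosed.splits p).eval_eq_prod_roots, norm_mul]
  congr 1
  simpa [Multiset.map_map] using
    map_multiset_prod (normHom : ℂ →*₀ ℝ) (p.roots.map fun θ => x - θ)

/-- If every complex root of a nonconstant integer polynomial is closer to `a` than to `b`, then
its value at `a` is smaller than its value at `b`. -/
theorem abs_eval_lt_abs_eval (p : ℤ[X]) (hp : 0 < p.natDegree) (a b : ℤ)
    (h : ∀ θ : ℂ, aeval θ p = 0 → ‖(a : ℂ) - θ‖ < ‖(b : ℂ) - θ‖) :
    |p.eval a| < |p.eval b| := by
  set q : ℂ[X] := p.map (Int.castRingHom ℂ) with hq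
  have hqdeg : q.natDegree = p.natDegree :=
    natDegree_map_eq_of_injective (RingHom.injective_int _) p
  have hq0 : q ≠ 0 := by rintro h0; simp [h0] at hqdeg; omega
  have hroots : q.roots ≠ 0 := by
    intro h0
    have := IsAlgClosed.card_roots_eq_natDegree (p := q)
    simp [h0] at this; omega
  have heval (x : ℤ) : ‖q.eval (x : ℂ)‖ = ((|p.eval x| : ℤ) : ℝ) := by
    rw [hq, eval_intCast_map]; simp
  have hlt : ((|p.eval a| : ℤ) : ℝ) < ((|p.eval b| : ℤ) : ℝ) := by
    rw [← heval, ← heval, norm_eval_eq_prod_roots, norm_eval_eq_prod_roots]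
    refine mul_lt_mul_of_pos_left ?_ (norm_pos_iff.mpr (leadingCoeff_ne_zero.mpr hq0))
    refine multiset_prod_map_lt _ _ _ hroots (fun _ _ => norm_nonneg _) fun θ hθ => h θ ?_
    have := (mem_roots'.mp hθ).2
    rwa [hq, IsRoot, eval_map, ← algebraMap_int_eq, ← aeval_def] at this
  exact_mod_cast hlt

theorem norm_sub_lt_norm_sub_iff (a b : ℤ) (θ : ℂ) :
    ‖(a : ℂ) - θ‖ < ‖(b : ℂ) - θ‖ ↔ 0 < ((b : ℝ) - a) * (a + b - 2 * θ.re) := by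
  rw [← sq_lt_sq₀ (norm_nonneg _) (norm_nonneg _), ← Complex.normSq_eq_norm_sq,
    ← Complex.normSq_eq_norm_sq, Complex.normSq_apply, Complex.normSq_apply]
  simp only [Complex.sub_re, Complex.sub_im, Complex.intCast_re, Complex.intCast_im]
  constructor <;> intro h <;> nlinarith

theorem isCoprime_eval_of_isCoprime_eval_derivative {g h : ℤ[X]} {x : ℤ}
    (hc : Int.gcd ((g * h).eval x) ((g * h).derivative.eval x) = 1) :
    IsCoprime (g.eval x) (h.eval x) := by
  obtain ⟨u, v, huv⟩ := Int.isCoprime_iff_gcd_eq_one.mpr hc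
  simp only [derivative_mul, eval_add, eval_mul] at huv
  exact ⟨u * h.eval x + v * h.derivative.eval x, v * g.derivative.eval x, by linear_combination huv⟩

theorem unitaryDivisor_abs_eval {g h : ℤ[X]} {x : ℤ} (hg : g.eval x ≠ 0)
    (hc : IsCoprime (g.eval x) (h.eval x)) : UnitaryDivisor (g * h) x |g.eval x| := by
  refine ⟨by simp [eval_mul], ?_⟩
  rw [eval_mul]
  rcases abs_choice (g.eval x) with h' | h' <;> rw [h']
  · rw [Int.mul_ediv_cancel_left _ hg]
    exact Int.isCoprime_iff_gcd_eq_one.mp hc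
  · rw [Int.ediv_neg, Int.mul_ediv_cancel_left _ hg, Int.gcd_neg, Int.neg_gcd]
    exact Int.isCoprime_iff_gcd_eq_one.mp hc

/-- A polynomial over `ℤ` of positive degree which is reducible over `ℚ` is a product of two
integer polynomials of positive degree. -/
theorem exists_factors_of_not_irreducible_map {f : ℤ[X]} (hdeg : 0 < f.natDegree)
    (hf : ¬ Irreducible (f.map (Int.castRingHom ℚ))) :
    ∃ g h : ℤ[X], f = g * h ∧ 0 < g.natDegree ∧ 0 < h.natDegree := by
  have hf0 : f ≠ 0 := by rintro rfl; simp at hdeg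
  have hc0 : f.content ≠ 0 := content_eq_zero_iff.not.mpr hf0
  have hprim := f.isPrimitive_primPart
  have hdegP {g : ℤ[X]} (hg : g ∣ f.primPart) (hu : ¬ IsUnit g) : 0 < g.natDegree := by
    by_contra! h0
    obtain ⟨c, rfl⟩ := natDegree_eq_zero.mp (Nat.le_zero.mp h0)
    exact hu (isUnit_C.mpr (isPrimitive_of_dvd hprim hg c dvd_rfl))
  have hnot : ¬ Irreducible f.primPart := by
    intro hirr
    rw [IsPrimitive.Int.irreducible_iff_irreducible_map_cast hprim] at hirr
    apply hf
    rw [f.eq_C_content_mul_primPart, Polynomial.map_mul, map_C]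
    refine (irreducible_isUnit_mul (isUnit_C.mpr ?_)).mpr hirr
    simpa using hc0
  have hnu : ¬ IsUnit f.primPart := fun hu => by
    have := natDegree_eq_zero_of_isUnit hu
    rw [natDegree_primPart] at this
    omega
  rw [irreducible_iff] at hnot
  push Not at hnot
  obtain ⟨g, h, hgh, hg, hh⟩ := hnot hnu
  refine ⟨C f.content * g, h, ?_, ?_, hdegP (hgh ▸ dvd_mul_left h g) hh⟩
  · rw [mul_assoc, ← hgh, ← f.eq_C_content_mul_primPart]
  · rw [natDegree_C_mul hc0]
    exact hdegP (hgh ▸ dvd_mul_right g h) hg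

/-- A factor whose value does not grow faster than the square root is bounded by the greatest
quotient of unitary divisors. -/
theorem abs_eval_le_of_sq_le {g h : ℤ[X]} {a b : ℤ}
    (ha : (g * h).eval a ≠ 0) (hb : (g * h).eval b ≠ 0)
    (hca : Int.gcd ((g * h).eval a) ((g * h).derivative.eval a) = 1)
    (hcb : Int.gcd ((g * h).eval b) ((g * h).derivative.eval b) = 1)
    (hq : IsGreatest (unitaryQuotients (g * h) a b) 1)
    (hle : |g.eval b| * |h.eval a| ≤ |g.eval a| * |h.eval b|) :
    |g.eval b| ≤ |g.eval a| := by
  rw [eval_mul] at ha hb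
  obtain ⟨hga, hha⟩ := mul_ne_zero_iff.mp ha
  obtain ⟨hgb, hhb⟩ := mul_ne_zero_iff.mp hb
  have hga' : (0 : ℝ) < ((|g.eval a| : ℤ) : ℝ) := by exact_mod_cast abs_pos.mpr hga
  have hha' : (0 : ℝ) < ((|h.eval a| : ℤ) : ℝ) := by exact_mod_cast abs_pos.mpr hha
  have hgb' : (0 : ℝ) < ((|g.eval b| : ℤ) : ℝ) := by exact_mod_cast abs_pos.mpr hgb
  have hle' : ((|g.eval b| : ℤ) : ℝ) * ((|h.eval a| : ℤ) : ℝ) ≤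
      ((|g.eval a| : ℤ) : ℝ) * ((|h.eval b| : ℤ) : ℝ) := by exact_mod_cast hle
  have hmem : ((|g.eval b| : ℤ) : ℝ) / ((|g.eval a| : ℤ) : ℝ) ∈ unitaryQuotients (g * h) a b := by
    refine ⟨_, _, unitaryDivisor_abs_eval hga (isCoprime_eval_of_isCoprime_eval_derivative hca),
      unitaryDivisor_abs_eval hgb (isCoprime_eval_of_isCoprime_eval_derivative hcb), rfl, ?_⟩
    apply Real.le_sqrt_of_sq_le
    rw [eval_mul, eval_mul, abs_mul, abs_mul, Int.cast_mul, Int.cast_mul, div_pow,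
      div_le_div_iff₀ (by positivity) (by positivity)]
    nlinarith [mul_le_mul_of_nonneg_left hle' (mul_pos hgb' hga').le]
  have := hq.2 hmem
  rw [div_le_one hga'] at this
  exact_mod_cast this

theorem statement_11 (f : Polynomial ℤ) (hdeg : 1 ≤ f.natDegree) (a b : ℤ)
    (hfa : 0 < |f.eval a|) (hfab : |f.eval a| < |f.eval b|)
    (hca : Int.gcd (f.eval a) (f.derivative.eval a) = 1)
    (hcb : Int.gcd (f.eval b) (f.derivative.eval b) = 1)
    (hq : IsGreatest (unitaryQuotients f a b) 1)
    (hroots :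
      (a < b ∧ ∀ θ : ℂ, (Polynomial.aeval θ) f = 0 → θ.re < ((a : ℝ) + (b : ℝ)) / 2) ∨
      (b < a ∧ ∀ θ : ℂ, (Polynomial.aeval θ) f = 0 → ((a : ℝ) + (b : ℝ)) / 2 < θ.re)) :
    Irreducible (Polynomial.map (Int.castRingHom ℚ) f) := by
  by_contra hirr
  obtain ⟨g, h, rfl, hg, hh⟩ := exists_factors_of_not_irreducible_map hdeg hirr
  have hnorm : ∀ θ : ℂ, aeval θ (g * h) = 0 → ‖(a : ℂ) - θ‖ < ‖(b : ℂ) - θ‖ := by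
    intro θ hθ
    rw [norm_sub_lt_norm_sub_iff]
    rcases hroots with ⟨hab, hr⟩ | ⟨hab, hr⟩
    · have hab' : (a : ℝ) < b := by exact_mod_cast hab
      exact mul_pos (by linarith) (by linarith [hr θ hθ])
    · have hab' : (b : ℝ) < a := by exact_mod_cast hab
      exact mul_pos_of_neg_of_neg (by linarith) (by linarith [hr θ hθ])
  have hglt := abs_eval_lt_abs_eval g hg a b fun θ hθ => hnorm θ (by rw [map_mul, hθ, zero_mul])
  have hhlt := abs_eval_lt_abs_eval h hh a b fun θ hθ => hnorm θ (by rw [map_mul, hθ, mul_zero])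
  have ha := abs_pos.mp hfa
  have hb := abs_pos.mp (hfa.trans hfab)
  rcases le_total (|g.eval b| * |h.eval a|) (|g.eval a| * |h.eval b|) with hle | hle
  · exact hglt.not_ge (abs_eval_le_of_sq_le ha hb hca hcb hq hle)
  · rw [mul_comm g h] at ha hb hca hcb hq
    exact hhlt.not_ge (abs_eval_le_of_sq_le ha hb hca hcb hq (by linarith))
end

section
/- Let f(X) = a_0 + a_1 X + ... + a_n X^n be a polynomial with integer coefficients of degree n ≥ 1, and let a, b be two integers such that a² < b² and |a_n| > Σ_{i=0}^{n-1} |a_i| · (|a+b|/2)^{i−n}. Suppose |f(a)| = p^{k_1}·r and |f(b)| = p^{k_2} for some prime number p and integers k_1, k_2, r with 0 ≤ k_1 < k_2, 0 < r < p, p ∤ f'(a)·f'(b) and r ∤ f'(a). Then f is irreducible over ℚ. -/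
open Polynomial

theorem Multiset.prod_map_lt_prod_map_of_nonneg {ι : Type*} {s : Multiset ι} (hs : s ≠ 0)
    {u v : ι → ℝ} (hu : ∀ i ∈ s, 0 ≤ u i) (huv : ∀ i ∈ s, u i < v i) :
    (s.map u).prod < (s.map v).prod := by
  induction s using Multiset.induction_on with
  | empty => exact absurd rfl hs
  | cons i s ih =>
    rw [Multiset.map_cons, Multiset.map_cons, Multiset.prod_cons, Multiset.prod_cons]
    have hi := Multiset.mem_cons_self i s
    rcases eq_or_ne s 0 with rfl | hs'
    · simpa using huv i hi
    · refine mul_lt_mul'' (huv i hi) (ih hs' (fun j hj => hu j (Multiset.mem_cons_of_mem hj))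
        (fun j hj => huv j (Multiset.mem_cons_of_mem hj))) (hu i hi) ?_
      refine Multiset.prod_nonneg fun x hx => ?_
      obtain ⟨j, hj, rfl⟩ := Multiset.mem_map.1 hx
      exact hu j (Multiset.mem_cons_of_mem hj)

namespace Polynomial

/-- If every root of a nonconstant complex polynomial is strictly closer to `x` than to `y`, then
the polynomial is strictly smaller in norm at `x` than at `y`. -/
theorem norm_eval_lt_norm_eval_of_roots {g : ℂ[X]} (hg : g.natDegree ≠ 0) {x y : ℂ}
    (h : ∀ z ∈ g.roots, ‖x - z‖ < ‖y - z‖) : ‖g.eval x‖ < ‖g.eval y‖ := by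
  have hsplit := IsAlgClosed.splits g
  have hg0 : g ≠ 0 := by
    rintro rfl
    simp at hg
  have hroots : g.roots ≠ 0 := by
    intro h0
    apply hg
    rw [hsplit.natDegree_eq_card_roots, h0, Multiset.card_zero]
  have heval (w : ℂ) :
      ‖g.eval w‖ = ‖g.leadingCoeff‖ * (g.roots.map fun z => ‖w - z‖).prod := by
    rw [hsplit.eval_eq_prod_roots, norm_mul]
    congr 1
    rw [← normHom_apply, map_multiset_prod, Multiset.map_map]
    rfl
  rw [heval, heval]
  exact mul_lt_mul_of_pos_left
    (Multiset.prod_map_lt_prod_map_of_nonneg hroots (fun z _ => norm_nonneg _) h)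
    (norm_pos_iff.2 (leadingCoeff_ne_zero.2 hg0))

/-- A Cauchy-type bound: if the leading coefficient dominates the others with weights
`δ ^ (i - n)`, then all complex roots have norm less than `δ`. -/
theorem norm_lt_of_eval_eq_zero_of_leadingCoeff_gt {f : ℂ[X]} {δ : ℝ} (hδ : 0 < δ)
    (hlead : ∑ i ∈ Finset.range f.natDegree,
      ‖f.coeff i‖ * δ ^ ((i : ℤ) - (f.natDegree : ℤ)) < ‖f.leadingCoeff‖)
    {z : ℂ} (hz : f.eval z = 0) : ‖z‖ < δ := by
  by_contra! hle
  have hz0 : 0 < ‖z‖ := hδ.trans_le hle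
  rw [eval_eq_sum_range, Finset.sum_range_succ] at hz
  have hlead_eq : ‖f.leadingCoeff‖ * ‖z‖ ^ f.natDegree =
      ‖∑ i ∈ Finset.range f.natDegree, f.coeff i * z ^ i‖ := by
    rw [eq_neg_of_add_eq_zero_left hz, norm_neg, norm_mul, norm_pow, leadingCoeff]
  have hsum : ‖∑ i ∈ Finset.range f.natDegree, f.coeff i * z ^ i‖ ≤
      (∑ i ∈ Finset.range f.natDegree,
        ‖f.coeff i‖ * δ ^ ((i : ℤ) - (f.natDegree : ℤ))) * ‖z‖ ^ f.natDegree := by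
    rw [Finset.sum_mul]
    refine norm_sum_le_of_le _ fun i hi => ?_
    rw [norm_mul, norm_pow, mul_assoc]
    refine mul_le_mul_of_nonneg_left ?_ (norm_nonneg _)
    have hin : i ≤ f.natDegree := (Finset.mem_range.1 hi).le
    have hpow : δ ^ ((i : ℤ) - (f.natDegree : ℤ)) = (δ ^ (f.natDegree - i))⁻¹ := by
      rw [← zpow_natCast, ← zpow_neg, Nat.cast_sub hin, neg_sub]
    rw [hpow, ← pow_sub_mul_pow ‖z‖ hin, ← mul_assoc]
    refine le_mul_of_one_le_left (by positivity) ?_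
    rw [inv_mul_eq_div, one_le_div (by positivity)]
    gcongr
  have := mul_lt_mul_of_pos_right hlead (pow_pos hz0 f.natDegree)
  linarith

end Polynomial

theorem Complex.norm_intCast_sub_lt_of_norm_lt {a b : ℤ} (hab : a ^ 2 < b ^ 2) {z : ℂ}
    (hz : ‖z‖ < ((|a + b| : ℤ) : ℝ) / 2) : ‖(a : ℂ) - z‖ < ‖(b : ℂ) - z‖ := by
  have hre : |z.re| < |(a : ℝ) + b| / 2 := by
    have := (Complex.abs_re_le_norm z).trans_lt hz
    simpa using this
  have hab' : (a : ℝ) ^ 2 < (b : ℝ) ^ 2 := by exact_mod_cast hab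
  have hba : 0 < |(b : ℝ) - a| := by
    rw [abs_pos, sub_ne_zero]
    rintro h
    rw [h] at hab'
    exact lt_irrefl _ hab'
  have hprod : |(b : ℝ) - a| * |(a : ℝ) + b| = (b : ℝ) ^ 2 - a ^ 2 := by
    rw [← abs_mul, abs_of_pos] <;> nlinarith
  have hle : (b - a) * z.re ≤ |(b : ℝ) - a| * |z.re| := by
    rw [← abs_mul]
    exact le_abs_self _
  have hlt := mul_lt_mul_of_pos_left hre hba
  rw [← sq_lt_sq₀ (norm_nonneg _) (norm_nonneg _), Complex.sq_norm, Complex.sq_norm,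
    Complex.normSq_apply, Complex.normSq_apply]
  simp only [Complex.sub_re, Complex.sub_im, Complex.intCast_re, Complex.intCast_im]
  nlinarith

namespace Polynomial

theorem eval_intCast_map_complex (g : ℤ[X]) (m : ℤ) :
    (g.map (Int.castRingHom ℂ)).eval (m : ℂ) = ((g.eval m : ℤ) : ℂ) := by
  rw [eval_intCast_map, eq_intCast, Int.cast_id]

/-- A primitive-part criterion: an integer polynomial of positive degree is irreducible over `ℚ`
as soon as it is not a product of two nonconstant integer polynomials. -/
theorem irreducible_map_rat_of_forall_mul {f : ℤ[X]} (hdeg : f.natDegree ≠ 0)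
    (h : ∀ g k : ℤ[X], f = g * k → g.natDegree = 0 ∨ k.natDegree = 0) :
    Irreducible (f.map (Int.castRingHom ℚ)) := by
  have hf0 : f ≠ 0 := by
    rintro rfl
    simp at hdeg
  have hunit {q : ℤ[X]} (hq : q ∣ f.primPart) (hq0 : q.natDegree = 0) : IsUnit q := by
    rw [eq_C_of_natDegree_eq_zero hq0] at hq ⊢
    exact (f.isPrimitive_primPart _ hq).map C
  have hprim : Irreducible f.primPart := by
    refine ⟨fun hu => hdeg ?_, fun g k hgk => ?_⟩
    · rw [← natDegree_primPart, natDegree_eq_zero_of_isUnit hu]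
    · have hc : f.content ≠ 0 := content_eq_zero_iff.not.2 hf0
      have hfac : f = (C f.content * g) * k := by
        rw [mul_assoc, ← hgk]
        exact f.eq_C_content_mul_primPart
      refine (h _ _ hfac).imp (fun hg => ?_) (fun hk => ?_)
      · rw [natDegree_C_mul hc] at hg
        exact hunit ⟨k, hgk⟩ hg
      · exact hunit ⟨g, hgk.trans (mul_comm g k)⟩ hk
  have hmap := (IsPrimitive.Int.irreducible_iff_irreducible_map_cast f.isPrimitive_primPart).1 hprim
  have hc : IsUnit (C (f.content : ℚ)) :=
    isUnit_C.2 (isUnit_iff_ne_zero.2 (Int.cast_ne_zero.2 (content_eq_zero_iff.not.2 hf0)))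
  rw [f.eq_C_content_mul_primPart, Polynomial.map_mul, map_C, eq_intCast]
  exact (irreducible_isUnit_mul hc).2 hmap

/-- If `f b` is, up to sign, a power of a prime `p` not dividing `f' b`, then one of the factors
in any factorization of `f` is a unit at `b`. -/
theorem isUnit_eval_or_isUnit_eval_of_mul {g h : ℤ[X]} {b : ℤ} {p : ℕ} (hp : p.Prime) {k : ℕ}
    (hb : |(g * h).eval b| = (p : ℤ) ^ k) (hd : ¬ (p : ℤ) ∣ (derivative (g * h)).eval b) :
    IsUnit (g.eval b) ∨ IsUnit (h.eval b) := by
  have hp' : Prime (p : ℤ) := Nat.prime_iff_prime_int.1 hp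
  have key {q : ℤ[X]} (hq : q.eval b ∣ (g * h).eval b) (hpq : ¬ (p : ℤ) ∣ q.eval b) :
      IsUnit (q.eval b) := by
    have hq' : q.eval b ∣ (p : ℤ) ^ k := hb ▸ (dvd_abs _ _).2 hq
    have hcop : IsCoprime ((p : ℤ) ^ k) (q.eval b) :=
      ((Prime.coprime_iff_not_dvd hp').2 hpq).pow_left
    exact hcop.isUnit_of_dvd' hq' dvd_rfl
  by_cases hg : (p : ℤ) ∣ g.eval b
  · refine Or.inr (key ⟨g.eval b, by rw [eval_mul, mul_comm]⟩ fun hh => hd ?_)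
    rw [derivative_mul, eval_add, eval_mul, eval_mul]
    exact dvd_add (hh.mul_left _) (hg.mul_right _)
  · exact Or.inl (key ⟨h.eval b, eval_mul⟩ hg)

end Polynomial

theorem statement_14 (f : Polynomial ℤ) (hdeg : 1 ≤ f.natDegree) (a b : ℤ)
    (hab : a ^ 2 < b ^ 2)
    (hlead : ((|f.leadingCoeff| : ℤ) : ℝ) >
      ∑ i ∈ Finset.range f.natDegree,
        ((|f.coeff i| : ℤ) : ℝ) * (((|a + b| : ℤ) : ℝ) / 2) ^ ((i : ℤ) - (f.natDegree : ℤ)))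
    (p : ℕ) (hp : p.Prime) (k₁ k₂ : ℕ) (r : ℤ)
    (hk : k₁ < k₂) (hr0 : 0 < r) (hrp : r < (p : ℤ))
    (hfa : |f.eval a| = (p : ℤ) ^ k₁ * r)
    (hfb : |f.eval b| = (p : ℤ) ^ k₂)
    (hpd : ¬ ((p : ℤ) ∣ f.derivative.eval a * f.derivative.eval b))
    (hrd : ¬ (r ∣ f.derivative.eval a)) :
    Irreducible (Polynomial.map (Int.castRingHom ℚ) f) := by
  have hf0 : f ≠ 0 := by
    rintro rfl
    simp at hdeg
  have hfa0 : f.eval a ≠ 0 := by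
    have : 0 < |f.eval a| := hfa ▸ mul_pos (pow_pos (by exact_mod_cast hp.pos) _) hr0
    exact abs_pos.1 this
  have hinj : Function.Injective (Int.castRingHom ℂ) := Int.cast_injective
  have hδ : 0 < ((|a + b| : ℤ) : ℝ) / 2 := by
    have hne : a + b ≠ 0 := fun h => by
      rw [eq_neg_of_add_eq_zero_left h, neg_sq] at hab
      exact lt_irrefl _ hab
    have : 0 < |a + b| := abs_pos.2 hne
    have : (0 : ℝ) < ((|a + b| : ℤ) : ℝ) := by exact_mod_cast this
    positivity
  have hroot {z : ℂ} (hz : (f.map (Int.castRingHom ℂ)).eval z = 0) :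
      ‖z‖ < ((|a + b| : ℤ) : ℝ) / 2 := by
    refine norm_lt_of_eval_eq_zero_of_leadingCoeff_gt hδ ?_ hz
    rw [natDegree_map_eq_of_injective hinj, leadingCoeff_map_of_injective hinj]
    simpa only [coeff_map, eq_intCast, Complex.norm_intCast, Int.cast_abs] using hlead
  have hdvd {g : ℤ[X]} (hg : g ∣ f) (hu : IsUnit (g.eval b)) : g.natDegree = 0 := by
    by_contra hg0
    have hlt : ‖(g.map (Int.castRingHom ℂ)).eval (a : ℂ)‖ <
        ‖(g.map (Int.castRingHom ℂ)).eval (b : ℂ)‖ := by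
      refine norm_eval_lt_norm_eval_of_roots ?_ fun z hz => ?_
      · rwa [natDegree_map_eq_of_injective hinj]
      · exact Complex.norm_intCast_sub_lt_of_norm_lt hab (hroot
          (eval_eq_zero_of_dvd_of_eval_eq_zero (Polynomial.map_dvd _ hg) (isRoot_of_mem_roots hz)))
    rw [eval_intCast_map_complex, eval_intCast_map_complex, Complex.norm_intCast,
      Complex.norm_intCast] at hlt
    have hlt' : |g.eval a| < |g.eval b| := by exact_mod_cast hlt
    rw [Int.isUnit_iff_abs_eq.1 hu, Int.abs_lt_one_iff] at hlt'
    exact hfa0 (eval_eq_zero_of_dvd_of_eval_eq_zero hg hlt')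
  refine irreducible_map_rat_of_forall_mul (by lia) fun g h hgh => ?_
  have hpb : ¬ (p : ℤ) ∣ f.derivative.eval b := fun h => hpd (h.mul_left _)
  rw [hgh] at hfb hpb
  exact (isUnit_eval_or_isUnit_eval_of_mul hp hfb hpb).imp
    (hdvd ⟨h, hgh⟩) (hdvd ⟨g, hgh.trans (mul_comm g h)⟩)
end

section
/- Let f(X) = a_0 + a_1 X + ... + a_n X^n be a polynomial with integer coefficients with a_0·a_n ≠ 0 and |a_n| > 2|a_{n−1}| + 2²|a_{n−2}| + ... + 2^n|a_0|. If for a non-zero integer m, a prime number p and an integer k ≥ 2 one has |f(m)| = p^k and p ∤ f'(m), then f is irreducible over ℚ. -/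
open Polynomial

/-- If every complex root of a nonconstant polynomial is strictly closer to `y` than to `x`, and `y`
is not a root, then the value at `y` is smaller than the value at `x`. -/
lemma norm_eval_lt_norm_eval_of_roots_closer {g : ℂ[X]} (hg : 0 < g.natDegree) {x y : ℂ}
    (hy : ¬ g.IsRoot y) (h : ∀ r, g.IsRoot r → ‖y - r‖ < ‖x - r‖) :
    ‖g.eval y‖ < ‖g.eval x‖ := by
  have hg0 : g ≠ 0 := ne_zero_of_natDegree_gt hg
  have hs : g.Splits := IsAlgClosed.splits g
  have hroots : g.roots ≠ 0 := by
    rw [← Multiset.card_pos, ← hs.natDegree_eq_card_roots]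
    exact hg
  have norm_eval (z : ℂ) :
      ‖g.eval z‖ = ‖g.leadingCoeff‖ * (g.roots.map fun r => ‖z - r‖).prod := by
    rw [hs.eval_eq_prod_roots, norm_mul]
    congr 1
    exact (map_multiset_prod (normHom : ℂ →*₀ ℝ) _).trans (by simp [Multiset.map_map])
  rw [norm_eval, norm_eval]
  refine mul_lt_mul_of_pos_left ?_ (norm_pos_iff.mpr (leadingCoeff_ne_zero.mpr hg0))
  refine Multiset.prod_map_lt_prod_map hroots _ _ (fun r hr => ?_)
    fun r hr => h r (isRoot_of_mem_roots hr)
  rw [norm_pos_iff, sub_ne_zero]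
  rintro rfl
  exact hy (isRoot_of_mem_roots hr)

/-- A polynomial with `∑_{i < n} 2 ^ (n - i) |a_i| < |a_n|` has all its complex roots in the open
disc of radius `1 / 2`. -/
lemma norm_lt_half_of_isRoot {f : ℤ[X]}
    (hlead : ∑ i ∈ Finset.range f.natDegree, 2 ^ (f.natDegree - i) * |f.coeff i| <
      |f.leadingCoeff|)
    {r : ℂ} (hr : (f.map (Int.castRingHom ℂ)).IsRoot r) : ‖r‖ < 1 / 2 := by
  by_contra! hhalf
  set n := f.natDegree with hn
  have hpos : 0 < ‖r‖ := by linarith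
  have hlead' : ∑ i ∈ Finset.range n, (2 : ℝ) ^ (n - i) * ‖(f.coeff i : ℂ)‖ <
      ‖(f.leadingCoeff : ℂ)‖ := by
    simp only [Complex.norm_intCast]
    exact_mod_cast hlead
  have hsum : (f.leadingCoeff : ℂ) * r ^ n =
      -∑ i ∈ Finset.range n, (f.coeff i : ℂ) * r ^ i := by
    rw [IsRoot.def, eval_map, eval₂_eq_sum_range, Finset.sum_range_succ] at hr
    exact eq_neg_of_add_eq_zero_right hr
  have hle : ‖(f.leadingCoeff : ℂ)‖ * ‖r‖ ^ n ≤
      (∑ i ∈ Finset.range n, (2 : ℝ) ^ (n - i) * ‖(f.coeff i : ℂ)‖) * ‖r‖ ^ n := by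
    rw [← norm_pow, ← norm_mul, hsum, norm_neg, Finset.sum_mul]
    refine norm_sum_le_of_le _ fun i hi => ?_
    have hin : n - i + i = n := Nat.sub_add_cancel (Finset.mem_range.mp hi).le
    have h1 : 1 ≤ (2 * ‖r‖) ^ (n - i) := one_le_pow₀ (by linarith)
    calc ‖(f.coeff i : ℂ) * r ^ i‖ = 1 * (‖(f.coeff i : ℂ)‖ * ‖r‖ ^ i) := by simp
      _ ≤ (2 * ‖r‖) ^ (n - i) * (‖(f.coeff i : ℂ)‖ * ‖r‖ ^ i) := by gcongr
      _ = 2 ^ (n - i) * ‖(f.coeff i : ℂ)‖ * ‖r ^ n‖ := by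
        rw [norm_pow, ← hin, Nat.add_sub_cancel, mul_pow, pow_add]
        ring
  exact absurd (le_of_mul_le_mul_right hle (pow_pos hpos n)) (not_le.mpr hlead')

/-- A nonconstant integer polynomial with nonzero constant term and all complex roots in the open
disc of radius `1 / 2` does not take a unit value at a nonzero integer. -/
lemma not_isUnit_eval_of_roots_small {g : ℤ[X]} (hg : 0 < g.natDegree) (hg0 : g.coeff 0 ≠ 0)
    (hroots : ∀ r : ℂ, (g.map (Int.castRingHom ℂ)).IsRoot r → ‖r‖ < 1 / 2)
    {m : ℤ} (hm : m ≠ 0) : ¬ IsUnit (g.eval m) := by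
  intro hunit
  have hdeg : (g.map (Int.castRingHom ℂ)).natDegree = g.natDegree :=
    natDegree_map_eq_of_injective Int.cast_injective g
  have eval_cast (a : ℤ) : (g.map (Int.castRingHom ℂ)).eval (a : ℂ) = ((g.eval a : ℤ) : ℂ) := by
    rw [eval_intCast_map, eq_intCast, Int.cast_id]
  have hm1 : (1 : ℝ) ≤ ‖(m : ℂ)‖ := by
    rw [Complex.norm_intCast]
    exact_mod_cast Int.one_le_abs hm
  have hlt := norm_eval_lt_norm_eval_of_roots_closer (hdeg ▸ hg) (x := (m : ℂ))
    (y := ((0 : ℤ) : ℂ))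
    (by rw [IsRoot.def, eval_cast, Int.cast_eq_zero, ← coeff_zero_eq_eval_zero]; exact hg0)
    fun r hr => by
      have h1 := hroots r hr
      have h2 := norm_sub_norm_le (m : ℂ) r
      rw [Int.cast_zero, zero_sub, norm_neg]
      linarith
  rw [eval_cast, eval_cast, Complex.norm_intCast, Complex.norm_intCast,
    ← coeff_zero_eq_eval_zero] at hlt
  have hlt' : |g.coeff 0| < |g.eval m| := by exact_mod_cast hlt
  rw [Int.isUnit_iff_abs_eq.mp hunit] at hlt'
  exact absurd (Int.one_le_abs hg0) (not_le.mpr hlt')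

/-- A divisor of a prime power, up to sign, that is not divisible by the prime is a unit. -/
lemma isUnit_of_dvd_of_abs_eq_prime_pow {a b : ℤ} {p k : ℕ} (hp : p.Prime) (hab : a ∣ b)
    (hb : |b| = (p : ℤ) ^ k) (ha : ¬ (p : ℤ) ∣ a) : IsUnit a := by
  have hcop : IsCoprime ((p : ℤ) ^ k) a :=
    (((Nat.prime_iff_prime_int.mp hp).coprime_iff_not_dvd).mpr ha).pow_left
  exact hcop.isUnit_of_dvd' (hb ▸ (dvd_abs a b).mpr hab) dvd_rfl

theorem statement_18 (f : Polynomial ℤ) (hdeg : 1 ≤ f.natDegree)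
    (h0 : f.coeff 0 * f.leadingCoeff ≠ 0)
    (hlead : |f.leadingCoeff| >
      ∑ i ∈ Finset.range f.natDegree, 2 ^ (f.natDegree - i) * |f.coeff i|)
    (m : ℤ) (hm : m ≠ 0) (p : ℕ) (hp : p.Prime) (k : ℕ) (hk : 2 ≤ k)
    (hfm : |f.eval m| = (p : ℤ) ^ k)
    (hpd : ¬ ((p : ℤ) ∣ f.derivative.eval m)) :
    Irreducible (Polynomial.map (Int.castRingHom ℚ) f) := by
  have hprim : f.IsPrimitive := by
    rintro c ⟨q, rfl⟩
    refine isUnit_of_dvd_of_abs_eq_prime_pow hp ⟨q.eval m, by simp⟩ hfm fun hpc => hpd ?_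
    simpa using hpc.mul_right _
  have isUnit_factor {g h : ℤ[X]} (hgh : f = g * h) (hpg : ¬ (p : ℤ) ∣ g.eval m) :
      IsUnit g := by
    have hunit : IsUnit (g.eval m) :=
      isUnit_of_dvd_of_abs_eq_prime_pow hp ⟨h.eval m, by rw [hgh, eval_mul]⟩ hfm hpg
    have hg0 : g.coeff 0 ≠ 0 := fun hg => h0 (by rw [hgh, mul_coeff_zero, hg]; simp)
    have hgdeg : g.natDegree = 0 := by
      by_contra hne
      refine not_isUnit_eval_of_roots_small (Nat.pos_of_ne_zero hne) hg0 (fun r hr => ?_) hm hunit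
      refine norm_lt_half_of_isRoot hlead (hr.dvd ?_)
      exact Polynomial.map_dvd _ ⟨h, hgh⟩
    rw [eq_C_of_natDegree_eq_zero hgdeg, eval_C] at hunit
    rw [eq_C_of_natDegree_eq_zero hgdeg]
    exact hunit.map C
  refine (IsPrimitive.Int.irreducible_iff_irreducible_map_cast hprim).mp ⟨fun hf => ?_, ?_⟩
  · rw [natDegree_eq_zero_of_isUnit hf] at hdeg
    omega
  · intro g h hgh
    by_cases hpg : (p : ℤ) ∣ g.eval m
    · refine Or.inr (isUnit_factor (hgh.trans (mul_comm g h)) fun hph => hpd ?_)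
      rw [hgh, derivative_mul, eval_add, eval_mul, eval_mul]
      exact dvd_add (hph.mul_left _) (hpg.mul_right _)
    · exact Or.inl (isUnit_factor hgh hpg)
end

section
/- Let K be a field and let f(X,Y) = a_0(X) + a_1(X)·Y + ... + a_n(X)·Y^n ∈ K[X,Y] with a_0, ..., a_n ∈ K[X], a_0·a_n ≠ 0 and n ≥ 1. Assume that for two polynomials a(X), b(X) ∈ K[X] one has f(X,a(X))·f(X,b(X)) ≠ 0 and Δ := (deg f(X,b(X)) − deg f(X,a(X)))/2 ≥ 0, and let q = max { deg d_2 − deg d_1 ≤ Δ : d_1 an admissible divisor of f(X,a(X)), d_2 an admissible divisor of f(X,b(X)) }. If deg b(X) > max { deg a(X), max_{0 ≤ i ≤ n−1} (deg a_i − deg a_n)/(n−i) } + q, then f(X,Y) is irreducible over the rational function field K(X). -/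
open Polynomial

/-- `d` is an admissible divisor of `f(X, a(X))`: `d ∣ f(X,a(X))` and
`gcd(d, f(X,a(X))/d)` divides `gcd(f(X,a(X)), (∂f/∂Y)(X,a(X)))`. -/
def PolyAdmissibleDivisor {K : Type*} [Field K]
    (f : Polynomial (Polynomial K)) (a d : Polynomial K) : Prop :=
  letI : DecidableEq (Polynomial K) := Classical.decEq _
  d ∣ f.eval a ∧
    EuclideanDomain.gcd d (f.eval a / d) ∣
      EuclideanDomain.gcd (f.eval a) ((Polynomial.derivative f).eval a)

/-- The term of index `k` of `g ∈ K[X][Y]` has weight `deg g_k + k R`; a nonzero `g` has a term of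
maximal weight whose index is largest possible. -/
lemma exists_last_max_weight {K : Type*} [Field K] (R : ℚ) {g : K[X][X]} (hg : g ≠ 0) :
    ∃ i, g.coeff i ≠ 0 ∧
      (∀ k, g.coeff k ≠ 0 → ((g.coeff k).natDegree : ℚ) + k * R ≤ (g.coeff i).natDegree + i * R) ∧
      (∀ k, i < k → g.coeff k ≠ 0 →
        ((g.coeff k).natDegree : ℚ) + k * R < (g.coeff i).natDegree + i * R) := by
  obtain ⟨i, hi, hmax⟩ := g.support.exists_max_image
    (fun k => toLex (((g.coeff k).natDegree : ℚ) + k * R, k)) (by simpa using hg)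
  refine ⟨i, mem_support_iff.mp hi, fun k hk => ?_, fun k hik hk => ?_⟩
  · rcases Prod.Lex.toLex_le_toLex.mp (hmax k (mem_support_iff.mpr hk)) with h | h
    · exact h.le
    · exact h.1.le
  · rcases Prod.Lex.toLex_le_toLex.mp (hmax k (mem_support_iff.mpr hk)) with h | h
    · exact h
    · exact absurd h.2 (by simpa using hik)

lemma degree_finset_sum_lt {K ι : Type*} [Field K] (s : Finset ι) (p : ι → K[X]) {q : K[X]}
    (hq : q ≠ 0) (h : ∀ i ∈ s, p i ≠ 0 → (p i).natDegree < q.natDegree) :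
    (∑ i ∈ s, p i).degree < q.degree := by
  refine Finset.sum_induction p (fun r => r.degree < q.degree)
    (fun r t hr ht => (degree_add_le r t).trans_lt (max_lt hr ht)) ?_ fun i hi => ?_
  · simpa [bot_lt_iff_ne_bot] using hq
  · by_cases hp : p i = 0
    · simpa [hp, bot_lt_iff_ne_bot] using hq
    · rw [degree_eq_natDegree hp, degree_eq_natDegree hq]
      exact_mod_cast h i hi hp

/-- If the leading term of `g * h` has maximal weight, then so does the leading term of `g`. -/
lemma weight_le_leading_of_mul {K : Type*} [Field K] (R : ℚ) {g h : K[X][X]} (hg : g ≠ 0)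
    (hh : h ≠ 0)
    (hw : ∀ k, (g * h).coeff k ≠ 0 → (((g * h).coeff k).natDegree : ℚ) + k * R ≤
      (g * h).leadingCoeff.natDegree + (g * h).natDegree * R)
    (k : ℕ) (hk : g.coeff k ≠ 0) :
    ((g.coeff k).natDegree : ℚ) + k * R ≤ g.leadingCoeff.natDegree + g.natDegree * R := by
  obtain ⟨i, hi, hile, hilt⟩ := exists_last_max_weight R hg
  obtain ⟨j, hj, hjle, hjlt⟩ := exists_last_max_weight R hh
  have hij : g.coeff i * h.coeff j ≠ 0 := mul_ne_zero hi hj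
  have hdeg : ((g * h).coeff (i + j)).degree = (g.coeff i * h.coeff j).degree := by
    rw [coeff_mul, ← Finset.add_sum_erase _ _ (Finset.HasAntidiagonal.mem_antidiagonal.mpr rfl :
      (i, j) ∈ Finset.HasAntidiagonal.antidiagonal (i + j))]
    refine degree_add_eq_left_of_degree_lt (degree_finset_sum_lt _ _ hij ?_)
    rintro ⟨s, t⟩ hst hne
    obtain ⟨hne', hst⟩ := Finset.mem_erase.mp hst
    rw [Finset.HasAntidiagonal.mem_antidiagonal] at hst
    simp only at hst hne ⊢
    have hs := left_ne_zero_of_mul hne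
    have ht := right_ne_zero_of_mul hne
    rw [natDegree_mul hs ht, natDegree_mul hi hj]
    have hstQ : (s : ℚ) + t = i + j := by exact_mod_cast hst
    have hstR : (s : ℚ) * R + t * R = i * R + j * R := by rw [← add_mul, hstQ, add_mul]
    have : ((g.coeff s).natDegree : ℚ) + (h.coeff t).natDegree <
        (g.coeff i).natDegree + (h.coeff j).natDegree := by
      rcases lt_trichotomy i s with his | rfl | his
      · linarith [hilt s his hs, hjle t ht]
      · exact absurd (by simpa using hst) (fun h : t = j => hne' (by rw [h]))
      · linarith [hile s hs, hjlt t (by omega) ht]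
    exact_mod_cast this
  have hcoeff : (g * h).coeff (i + j) ≠ 0 := by
    rw [← degree_ne_bot, hdeg, degree_ne_bot]
    exact hij
  have h1 := hw _ hcoeff
  rw [natDegree_eq_of_degree_eq hdeg, natDegree_mul hi hj, leadingCoeff_mul,
    natDegree_mul (leadingCoeff_ne_zero.mpr hg) (leadingCoeff_ne_zero.mpr hh),
    natDegree_mul hg hh] at h1
  push_cast at h1
  have h2 := hjle _ (leadingCoeff_ne_zero.mpr hh)
  have h3 := hile k hk
  simp only [coeff_natDegree] at h2
  linarith

lemma natDegree_eval_le_of_weight_le {K : Type*} [Field K] {R : ℚ} {g : K[X][X]} {a : K[X]}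
    (hR : (a.natDegree : ℚ) ≤ R)
    (hw : ∀ k, g.coeff k ≠ 0 →
      ((g.coeff k).natDegree : ℚ) + k * R ≤ g.leadingCoeff.natDegree + g.natDegree * R) :
    ((g.eval a).natDegree : ℚ) ≤ g.leadingCoeff.natDegree + g.natDegree * R := by
  have hR0 : 0 ≤ R := le_trans (Nat.cast_nonneg _) hR
  rw [eval_eq_sum_range]
  refine Finset.sum_induction _
    (fun p : K[X] => (p.natDegree : ℚ) ≤ g.leadingCoeff.natDegree + g.natDegree * R)
    (fun p q hp hq => ?_) (by simp only [natDegree_zero]; positivity) fun k _ => ?_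
  · refine le_trans (Nat.cast_le.mpr (natDegree_add_le p q)) ?_
    rw [Nat.cast_max]
    exact max_le hp hq
  · by_cases hk : g.coeff k = 0
    · simp only [hk, zero_mul, natDegree_zero]
      positivity
    · refine le_trans ?_ (hw k hk)
      have h1 : (g.coeff k * a ^ k).natDegree ≤ (g.coeff k).natDegree + k * a.natDegree :=
        natDegree_mul_le.trans (by gcongr; exact natDegree_pow_le)
      have h2 : (k : ℚ) * a.natDegree ≤ k * R := by gcongr
      have h3 : ((g.coeff k * a ^ k).natDegree : ℚ) ≤ (g.coeff k).natDegree + k * a.natDegree := by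
        exact_mod_cast h1
      linarith

lemma natDegree_eval_eq_of_weight_le {K : Type*} [Field K] {R : ℚ} {g : K[X][X]} {b : K[X]}
    (hg : g ≠ 0) (hR0 : 0 ≤ R) (hR : R < b.natDegree)
    (hw : ∀ k, g.coeff k ≠ 0 →
      ((g.coeff k).natDegree : ℚ) + k * R ≤ g.leadingCoeff.natDegree + g.natDegree * R) :
    (g.eval b).natDegree = g.leadingCoeff.natDegree + g.natDegree * b.natDegree := by
  have hb : b ≠ 0 := by
    rintro rfl
    simp only [natDegree_zero, Nat.cast_zero] at hR
    linarith
  have hg' : g.coeff g.natDegree ≠ 0 := leadingCoeff_ne_zero.mpr hg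
  rw [eval_eq_sum_range, Finset.sum_range_succ, natDegree_add_eq_right_of_degree_lt,
    natDegree_mul hg' (pow_ne_zero _ hb), natDegree_pow, coeff_natDegree]
  refine degree_finset_sum_lt _ _ (mul_ne_zero hg' (pow_ne_zero _ hb)) fun k hk hne => ?_
  have hk' := left_ne_zero_of_mul hne
  rw [natDegree_mul hk' (pow_ne_zero _ hb), natDegree_mul hg' (pow_ne_zero _ hb), natDegree_pow,
    natDegree_pow, coeff_natDegree]
  have h1 := hw k hk'
  have h2 : (k : ℚ) < g.natDegree := by exact_mod_cast Finset.mem_range.mp hk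
  have h3 : (0 : ℚ) < (g.natDegree - k) * (b.natDegree - R) :=
    mul_pos (sub_pos.mpr h2) (sub_pos.mpr hR)
  have h4 : ((g.coeff k).natDegree : ℚ) + k * b.natDegree <
      g.leadingCoeff.natDegree + g.natDegree * b.natDegree := by linarith
  exact_mod_cast h4

/-- A factor `g` of positive degree gains more than `q` degrees on passing from `a` to `b`. -/
lemma lt_natDegree_eval_sub {K : Type*} [Field K] {R q : ℚ} {g : K[X][X]} {a b : K[X]}
    (hg : 0 < g.natDegree) (hq : 0 ≤ q) (ha : (a.natDegree : ℚ) ≤ R) (hb : R + q < b.natDegree)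
    (hw : ∀ k, g.coeff k ≠ 0 →
      ((g.coeff k).natDegree : ℚ) + k * R ≤ g.leadingCoeff.natDegree + g.natDegree * R) :
    q < (g.eval b).natDegree - (g.eval a).natDegree := by
  have h1 := natDegree_eval_le_of_weight_le ha hw
  have h2 := natDegree_eval_eq_of_weight_le (ne_zero_of_natDegree_gt hg)
    ((Nat.cast_nonneg a.natDegree).trans ha) (by linarith : R < (b.natDegree : ℚ)) hw
  have h3 : (1 : ℚ) ≤ g.natDegree := by exact_mod_cast hg
  have h4 := mul_le_mul_of_nonneg_right h3 (by linarith : 0 ≤ (b.natDegree : ℚ) - R)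
  rw [h2]
  push_cast
  linarith

lemma polyAdmissibleDivisor_eval_of_mul {K : Type*} [Field K] (g h : K[X][X]) {a : K[X]}
    (ha : (g * h).eval a ≠ 0) : PolyAdmissibleDivisor (g * h) a (g.eval a) := by
  let : DecidableEq K[X] := Classical.decEq _
  rw [eval_mul] at ha
  refine ⟨by simp, EuclideanDomain.dvd_gcd ?_ ?_⟩
  · exact (EuclideanDomain.gcd_dvd_left _ _).trans (by simp)
  · rw [eval_mul, mul_div_cancel_left₀ _ (left_ne_zero_of_mul ha), derivative_mul, eval_add,
      eval_mul, eval_mul]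
    exact dvd_add ((EuclideanDomain.gcd_dvd_right _ _).mul_left _)
      ((EuclideanDomain.gcd_dvd_left _ _).mul_right _)

lemma polyAdmissibleDivisor_one {K : Type*} [Field K] (f : K[X][X]) (a : K[X]) :
    PolyAdmissibleDivisor f a 1 := by
  let : DecidableEq K[X] := Classical.decEq _
  exact ⟨one_dvd _, (EuclideanDomain.gcd_dvd_left _ _).trans (one_dvd _)⟩

/-- A polynomial of positive degree over a UFD which is not a product of two factors of positive
degree is irreducible over the fraction field. -/
lemma irreducible_map_of_no_factorization {A : Type*} (F : Type*) [CommRing A] [IsDomain A]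
    [UniqueFactorizationMonoid A] [Field F] [Algebra A F] [IsFractionRing A F] {f : A[X]}
    (hf : 0 < f.natDegree)
    (H : ∀ g h : A[X], f = g * h → 0 < g.natDegree → 0 < h.natDegree → False) :
    Irreducible (f.map (algebraMap A F)) := by
  classical
  let : StrongNormalizationMonoid A := UniqueFactorizationMonoid.strongNormalizationMonoid
  let : NormalizedGCDMonoid A := UniqueFactorizationMonoid.toNormalizedGCDMonoid A
  have hc : f.content ≠ 0 := fun h => by
    rw [content_eq_zero_iff] at h
    simp [h] at hf
  have hprim := f.isPrimitive_primPart
  have hirr : Irreducible f.primPart := by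
    refine ⟨fun hu => ?_, fun g h hgh => ?_⟩
    · have := natDegree_eq_zero_of_isUnit hu
      rw [natDegree_primPart] at this
      omega
    · have hpos : ∀ p : A[X], p ∣ f.primPart → ¬ IsUnit p → 0 < p.natDegree := by
        intro p hp hu
        by_contra h0
        have hp' := eq_C_of_natDegree_eq_zero (Nat.eq_zero_of_not_pos h0)
        rw [hp'] at hp hu
        exact hu ((hprim _ hp).map C)
      by_contra! hcon
      refine H (C f.content * g) h ?_ ?_ (hpos h (hgh ▸ dvd_mul_left _ _) hcon.2)
      · rw [mul_assoc, ← hgh, ← eq_C_content_mul_primPart]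
      · rw [natDegree_C_mul hc]
        exact hpos g (hgh ▸ dvd_mul_right _ _) hcon.1
  have hmap := (hprim.irreducible_iff_irreducible_map_fraction_map (K := F)).mp hirr
  rw [f.eq_C_content_mul_primPart, Polynomial.map_mul, map_C]
  refine (irreducible_isUnit_mul ?_).mpr hmap
  exact isUnit_C.mpr (IsUnit.mk0 _ (by simpa using hc))

theorem statement_19 {K : Type*} [Field K]
    (f : Polynomial (Polynomial K)) (n : ℕ) (hn : 1 ≤ n) (hdegf : f.natDegree = n)
    (h0 : f.coeff 0 * f.coeff n ≠ 0)
    (a b : Polynomial K)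
    (hfab : f.eval a * f.eval b ≠ 0)
    (hΔ : (0 : ℚ) ≤ (((f.eval b).natDegree : ℚ) - ((f.eval a).natDegree : ℚ)) / 2)
    (q : ℤ)
    (hq : IsGreatest {m : ℤ | ∃ d₁ d₂ : Polynomial K,
      PolyAdmissibleDivisor f a d₁ ∧ PolyAdmissibleDivisor f b d₂ ∧
      m = (d₂.natDegree : ℤ) - (d₁.natDegree : ℤ) ∧
      (m : ℚ) ≤ (((f.eval b).natDegree : ℚ) - ((f.eval a).natDegree : ℚ)) / 2} q)
    (hb : (b.natDegree : ℚ) >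
      max ((a.natDegree : ℚ))
        ((Finset.range n).sup' (Finset.nonempty_range_iff.mpr (by omega))
          (fun i => (((f.coeff i).natDegree : ℚ) - ((f.coeff n).natDegree : ℚ)) /
            ((n : ℚ) - (i : ℚ)))) + (q : ℚ)) :
    Irreducible (Polynomial.map (algebraMap (Polynomial K) (RatFunc K)) f) := by
  have hmem : ∀ g h : K[X][X], f = g * h →
      (((g.eval b).natDegree : ℚ) - (g.eval a).natDegree ≤
        (((f.eval b).natDegree : ℚ) - ((f.eval a).natDegree : ℚ)) / 2) →
      ((g.eval b).natDegree : ℚ) - (g.eval a).natDegree ≤ q := by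
    rintro g h rfl hle
    have := hq.2 ⟨g.eval a, g.eval b,
      polyAdmissibleDivisor_eval_of_mul g h (left_ne_zero_of_mul hfab),
      polyAdmissibleDivisor_eval_of_mul g h (right_ne_zero_of_mul hfab), rfl,
      by push_cast; exact hle⟩
    exact_mod_cast this
  have hq0 : 0 ≤ q := hq.2 ⟨1, 1, polyAdmissibleDivisor_one f a, polyAdmissibleDivisor_one f b,
    by simp, by simpa using hΔ⟩
  set R : ℚ := max ((a.natDegree : ℚ))
    ((Finset.range n).sup' (Finset.nonempty_range_iff.mpr (by omega))
      (fun i => (((f.coeff i).natDegree : ℚ) - ((f.coeff n).natDegree : ℚ)) /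
        ((n : ℚ) - (i : ℚ)))) with hRdef
  have haR : (a.natDegree : ℚ) ≤ R := le_max_left _ _
  have hw : ∀ k, f.coeff k ≠ 0 →
      ((f.coeff k).natDegree : ℚ) + k * R ≤ f.leadingCoeff.natDegree + f.natDegree * R := by
    intro k hk
    rw [← coeff_natDegree, hdegf]
    rcases ((le_natDegree_of_ne_zero hk).trans_eq hdegf).eq_or_lt with rfl | hkn
    · exact le_rfl
    · have h1 : (((f.coeff k).natDegree : ℚ) - ((f.coeff n).natDegree : ℚ)) /
          ((n : ℚ) - (k : ℚ)) ≤ R :=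
        (Finset.le_sup' (fun i : ℕ => (((f.coeff i).natDegree : ℚ) -
          ((f.coeff n).natDegree : ℚ)) / ((n : ℚ) - (i : ℚ)))
          (Finset.mem_range.mpr hkn)).trans (le_max_right _ _)
      rw [div_le_iff₀ (sub_pos.mpr (by exact_mod_cast hkn))] at h1
      linarith
  have hgain : ∀ g h : K[X][X], f = g * h → 0 < g.natDegree → 0 < h.natDegree →
      (q : ℚ) < (g.eval b).natDegree - (g.eval a).natDegree := by
    rintro g h rfl hg hh
    exact lt_natDegree_eval_sub hg (by exact_mod_cast hq0) haR hb
      (weight_le_leading_of_mul R (ne_zero_of_natDegree_gt hg) (ne_zero_of_natDegree_gt hh) hw)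
  refine irreducible_map_of_no_factorization (RatFunc K) (by omega) fun g h hgh hg hh => ?_
  have hhg : f = h * g := hgh.trans (mul_comm g h)
  have h1 := hgain g h hgh hg hh
  have h2 := hgain h g hhg hh hg
  have hsum : ∀ c : K[X], f.eval c ≠ 0 →
      ((f.eval c).natDegree : ℚ) = (g.eval c).natDegree + (h.eval c).natDegree := by
    intro c hc
    rw [hgh, eval_mul] at hc ⊢
    rw [natDegree_mul (left_ne_zero_of_mul hc) (right_ne_zero_of_mul hc), Nat.cast_add]
  have ha := hsum a (left_ne_zero_of_mul hfab)
  have hb := hsum b (right_ne_zero_of_mul hfab)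
  rcases le_total (((g.eval b).natDegree : ℚ) - (g.eval a).natDegree)
    ((((f.eval b).natDegree : ℚ) - ((f.eval a).natDegree : ℚ)) / 2) with hle | hle
  · exact absurd (hmem g h hgh hle) (not_le.mpr h1)
  · exact absurd (hmem h g hhg (by linarith)) (not_le.mpr h2)
end
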